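/- Let Ω ∈ K^{n×ℓ} be either a Gaussian embedding or a random orthonormal embedding, and let A ∈ K^{n×d} and B ∈ K^{n×p} be matrices with r := rank(A) < ℓ − α_K. Then the sketch-and-solve solution X̂ = (Ω*A)⁺(Ω*B) is an unbiased estimator of the minimum-norm least-squares solution: E[X̂] = A⁺B. -/

import Mathlib

open MeasureTheory ProbabilityTheory Matrix Filter
open scoped ENNReal Topology ComplexOrder

noncomputable section

open Classical in
/-- `α_K`: 1 if `K = ℝ`, 0 if `K = ℂ`. -/
def alphaK (K : Type*) [RCLike K] : ℝ := if (RCLike.I : K) = 0 then 1 else 0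

/-- Squared Frobenius norm of a matrix. -/
def frobSq {K : Type*} [RCLike K] {m n : Type*} [Fintype m] [Fintype n]
    (A : Matrix m n K) : ℝ := ∑ i, ∑ j, ‖A i j‖ ^ 2

/-- The four Penrose conditions characterizing the Moore–Penrose pseudoinverse. -/
def IsMoorePenrose {K : Type*} [RCLike K] {m n : Type*} [Fintype m] [Fintype n]
    (A : Matrix m n K) (X : Matrix n m K) : Prop :=
  A * X * A = A ∧ X * A * X = X ∧ (A * X)ᴴ = A * X ∧ (X * A)ᴴ = X * A

instance matrixMeasurableSpace {m n α : Type*} [MeasurableSpace α] :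
    MeasurableSpace (Matrix m n α) :=
  inferInstanceAs (MeasurableSpace (m → n → α))

/-- `M` is rotation-invariant: `U * M` has the same distribution as `M` for every unitary `U`. -/
def RotationInvariant {K : Type*} [RCLike K] [MeasurableSpace K]
    {Y : Type*} [MeasurableSpace Y] (μ : Measure Y) {n ℓ : ℕ}
    (M : Y → Matrix (Fin n) (Fin ℓ) K) : Prop :=
  ∀ U : Matrix (Fin n) (Fin n) K, U ∈ Matrix.unitaryGroup (Fin n) K →
    Measure.map (fun ω => U * M ω) μ = Measure.map M μ

/-- `M` is a random orthonormal embedding: rotation-invariant, with orthonormal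
columns almost surely. -/
def IsRandomOrthonormal {K : Type*} [RCLike K] [MeasurableSpace K]
    {Y : Type*} [MeasurableSpace Y] (μ : Measure Y) {n ℓ : ℕ}
    (M : Y → Matrix (Fin n) (Fin ℓ) K) : Prop :=
  Measurable M ∧ RotationInvariant μ M ∧ ∀ᵐ ω ∂μ, (M ω)ᴴ * M ω = 1

open Classical in
/-- A standard normal sample in `K` built from two independent real coordinates:
for `K = ℝ` it is the first coordinate, for `K = ℂ` it is `(g₁ + i g₂)/√2`. -/
def stdGaussianEntry (K : Type*) [RCLike K] (v : Bool → ℝ) : K :=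
  if (RCLike.I : K) = 0 then (v false : K)
  else ((v false : K) + RCLike.I * (v true : K)) / (Real.sqrt 2 : K)

/-- The distribution of an `r × c` matrix with independent standard normal
`N_K(0,1)` entries. -/
def gaussianMatrix (K : Type*) [RCLike K] [MeasurableSpace K] (r c : ℕ) :
    Measure (Matrix (Fin r) (Fin c) K) :=
  Measure.map
    (fun g : Fin r → Fin c → Bool → ℝ => Matrix.of fun i j => stdGaussianEntry K (g i j))
    (Measure.pi fun _ : Fin r => Measure.pi fun _ : Fin c =>
      Measure.pi fun _ : Bool => gaussianReal 0 1)

/-- `M` is a Gaussian embedding: a random matrix with iid standard normal `N_K(0,1)` entries. -/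
def IsGaussianEmbedding {K : Type*} [RCLike K] [MeasurableSpace K]
    {Y : Type*} [MeasurableSpace Y] (μ : Measure Y) {n ℓ : ℕ}
    (M : Y → Matrix (Fin n) (Fin ℓ) K) : Prop :=
  Measurable M ∧ Measure.map M μ = gaussianMatrix K n ℓ


section LinAlg
variable {K : Type*} [RCLike K]

/-- Euclidean norm of a vector. -/
def l2 {m : ℕ} (v : Fin m → K) : ℝ := ‖(WithLp.toLp 2 v : EuclideanSpace K (Fin m))‖

/-- Frobenius norm. -/
def frob {m n : ℕ} (S : Matrix (Fin m) (Fin n) K) : ℝ := Real.sqrt (frobSq S)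

lemma l2_nonneg {m : ℕ} (v : Fin m → K) : 0 ≤ l2 v := norm_nonneg _

lemma l2_sq {m : ℕ} (v : Fin m → K) : l2 v ^ 2 = ∑ i, ‖v i‖ ^ 2 := by
  unfold l2; rw [EuclideanSpace.norm_sq_eq]

lemma l2_smul {m : ℕ} (c : K) (v : Fin m → K) : l2 (c • v) = ‖c‖ * l2 v := by
  unfold l2; rw [WithLp.toLp_smul, norm_smul]

lemma norm_le_l2 {m : ℕ} (v : Fin m → K) (i : Fin m) : ‖v i‖ ≤ l2 v := by
  have := PiLp.norm_apply_le (WithLp.toLp 2 v : EuclideanSpace K (Fin m)) i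
  simpa [l2] using this

lemma l2_continuous {m : ℕ} : Continuous (l2 : (Fin m → K) → ℝ) := by
  unfold l2
  exact (PiLp.continuous_toLp 2 _).norm

lemma l2_zero {m : ℕ} : l2 (0 : Fin m → K) = 0 := by simp [l2]

lemma l2_sq_dot {m : ℕ} (v : Fin m → K) : ((l2 v ^ 2 : ℝ) : K) = star v ⬝ᵥ v := by
  rw [l2_sq]; push_cast
  simp [dotProduct, RCLike.conj_mul]

lemma norm_dot_le {m : ℕ} (v w : Fin m → K) : ‖star v ⬝ᵥ w‖ ≤ l2 v * l2 w := by
  have := norm_inner_le_norm (𝕜 := K) (WithLp.toLp 2 v : EuclideanSpace K (Fin m)) (WithLp.toLp 2 w)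
  rw [EuclideanSpace.inner_eq_star_dotProduct] at this
  rw [dotProduct_comm]
  exact this

lemma frobSq_nonneg {m n : ℕ} (S : Matrix (Fin m) (Fin n) K) : 0 ≤ frobSq S := by
  unfold frobSq; positivity

lemma frob_nonneg {m n : ℕ} (S : Matrix (Fin m) (Fin n) K) : 0 ≤ frob S := Real.sqrt_nonneg _

lemma frobSq_eq_col {m n : ℕ} (S : Matrix (Fin m) (Fin n) K) :
    frobSq S = ∑ j, l2 (fun i => S i j) ^ 2 := by
  unfold frobSq; rw [Finset.sum_comm]; simp_rw [l2_sq]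

lemma frob_conjTranspose {m n : ℕ} (S : Matrix (Fin m) (Fin n) K) : frob Sᴴ = frob S := by
  unfold frob frobSq; rw [Finset.sum_comm]; simp

lemma l2_mulVec_le {m n : ℕ} (S : Matrix (Fin m) (Fin n) K) (v : Fin n → K) :
    l2 (S *ᵥ v) ≤ frob S * l2 v := by
  have h : l2 (S *ᵥ v) ^ 2 ≤ (frob S * l2 v) ^ 2 := by
    rw [mul_pow, frob, Real.sq_sqrt (frobSq_nonneg S), l2_sq, frobSq, Finset.sum_mul]
    refine Finset.sum_le_sum fun i _ => ?_
    have := norm_dot_le (star (S i)) v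
    rw [star_star] at this
    have h2 : l2 (star (S i)) ^ 2 = ∑ j, ‖S i j‖ ^ 2 := by rw [l2_sq]; simp
    rw [← h2, ← mul_pow]
    exact pow_le_pow_left₀ (norm_nonneg _) this 2
  exact le_of_sq_le_sq h (mul_nonneg (frob_nonneg _) (l2_nonneg _)) 

lemma l2_isometry {m n : ℕ} (U : Matrix (Fin m) (Fin n) K) (hU : Uᴴ * U = 1) (v : Fin n → K) :
    l2 (U *ᵥ v) = l2 v := by
  have h : ((l2 (U *ᵥ v) ^ 2 : ℝ) : K) = ((l2 v ^ 2 : ℝ) : K) := by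
    rw [l2_sq_dot, l2_sq_dot, star_mulVec, ← dotProduct_mulVec, mulVec_mulVec, hU, one_mulVec]
  have h' := RCLike.ofReal_inj.mp h
  exact (sq_eq_sq₀ (l2_nonneg _) (l2_nonneg _)).mp h'

lemma frob_isometry {m n k : ℕ} (U : Matrix (Fin m) (Fin n) K) (hU : Uᴴ * U = 1)
    (G : Matrix (Fin n) (Fin k) K) : frob (U * G) = frob G := by
  unfold frob
  congr 1
  rw [frobSq_eq_col, frobSq_eq_col]
  refine Finset.sum_congr rfl fun j _ => ?_
  have := l2_isometry U hU (fun i => G i j)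
  rw [← this]
  rfl

lemma frobSq_of_orthonormal {m n : ℕ} (U : Matrix (Fin m) (Fin n) K) (hU : Uᴴ * U = 1) :
    frobSq U = n := by
  have h := frob_isometry U hU (1 : Matrix (Fin n) (Fin n) K)
  rw [Matrix.mul_one] at h
  have h2 : frobSq U = frobSq (1 : Matrix (Fin n) (Fin n) K) := by
    unfold frob at h
    exact (Real.sqrt_inj (frobSq_nonneg _) (frobSq_nonneg _)).mp h
  rw [h2]
  simp [frobSq, Matrix.one_apply, apply_ite]

lemma exists_qr {m n : ℕ} (hmn : m ≤ n) (v : Fin m → Fin n → K) :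
    ∃ V ∈ Matrix.unitaryGroup (Fin n) K, ∀ k (i : Fin n), m ≤ i.val → (V *ᵥ v k) i = 0 := by
  let f : Fin n → EuclideanSpace K (Fin n) := fun j =>
    if h : j.val < m then WithLp.toLp 2 (v ⟨j, h⟩) else 0
  have hc : Module.finrank K (EuclideanSpace K (Fin n)) = Fintype.card (Fin n) := by simp
  let b := InnerProductSpace.gramSchmidtOrthonormalBasis hc f
  have hb : ∀ i (x : Fin n → K), ((Matrix.of fun i a => star (b i a)) *ᵥ x) i
      = inner K (b i) (WithLp.toLp 2 x) := by
    intro i x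
    simp [mulVec, dotProduct, PiLp.inner_apply, mul_comm]
  refine ⟨Matrix.of fun i a => star (b i a), ?_, ?_⟩
  · rw [Matrix.mem_unitaryGroup_iff]
    ext i j
    have h1 := (orthonormal_iff_ite.mp b.orthonormal) i j
    rw [Matrix.one_apply, ← h1]
    simp [Matrix.mul_apply, PiLp.inner_apply, Matrix.star_apply, mul_comm]
  · intro k i hi
    rw [hb]
    have := InnerProductSpace.gramSchmidtOrthonormalBasis_inv_triangular hc f
      (i := ⟨k.val, lt_of_lt_of_le k.2 hmn⟩) (j := i) (by
        rw [Fin.lt_def]; exact lt_of_lt_of_le k.2 hi)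
    simpa [f] using this

/-- Inverse of the smallest singular value (up to normalisation). -/
def ginv {ℓ r : ℕ} (T : Matrix (Fin ℓ) (Fin r) K) : ℝ≥0∞ :=
  ⨆ x : {x : Fin r → K // ∃ j, x j = 1}, (ENNReal.ofReal (l2 (T *ᵥ x.1)))⁻¹

lemma ginv_le_mul {ℓ k r : ℕ} (S : Matrix (Fin k) (Fin ℓ) K) (T : Matrix (Fin ℓ) (Fin r) K) :
    ginv T ≤ ENNReal.ofReal (1 + frob S) * ginv (S * T) := by
  refine iSup_le fun x => ?_
  have h1 : l2 ((S * T) *ᵥ x.1) ≤ (1 + frob S) * l2 (T *ᵥ x.1) := by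
    rw [← mulVec_mulVec]
    refine (l2_mulVec_le _ _).trans ?_
    nlinarith [l2_nonneg (T *ᵥ x.1)]
  have hp : 0 < 1 + frob S := by linarith [frob_nonneg S]
  have h2 : (ENNReal.ofReal (l2 ((S * T) *ᵥ x.1)))⁻¹ ≤ ginv (S * T) :=
    le_iSup (fun x : {x : Fin r → K // ∃ j, x j = 1} =>
      (ENNReal.ofReal (l2 ((S * T) *ᵥ x.1)))⁻¹) x
  have h0 : ENNReal.ofReal (1 + frob S) ≠ 0 := by simpa using hp
  calc (ENNReal.ofReal (l2 (T *ᵥ x.1)))⁻¹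
      = ENNReal.ofReal (1 + frob S) * (ENNReal.ofReal ((1 + frob S) * l2 (T *ᵥ x.1)))⁻¹ := by
        rw [ENNReal.ofReal_mul hp.le, ENNReal.mul_inv (Or.inl h0) (Or.inl ENNReal.ofReal_ne_top),
          ← mul_assoc, ENNReal.mul_inv_cancel h0 ENNReal.ofReal_ne_top, one_mul]
    _ ≤ ENNReal.ofReal (1 + frob S) * (ENNReal.ofReal (l2 ((S * T) *ᵥ x.1)))⁻¹ := by
        gcongr
    _ ≤ _ := by gcongr

lemma ginv_injective {ℓ r : ℕ} {T : Matrix (Fin ℓ) (Fin r) K} (h : ginv T ≠ ⊤)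
    {v : Fin r → K} (hv : T *ᵥ v = 0) : v = 0 := by
  by_contra hne
  obtain ⟨j, hj⟩ := Function.ne_iff.mp hne
  apply h
  rw [eq_top_iff]
  have h2 : (ENNReal.ofReal (l2 (T *ᵥ ((v j)⁻¹ • v))))⁻¹ ≤ ginv T :=
    le_iSup (fun x : {x : Fin r → K // ∃ j, x j = 1} =>
      (ENNReal.ofReal (l2 (T *ᵥ x.1)))⁻¹) ⟨(v j)⁻¹ • v, j, by simpa using inv_mul_cancel₀ hj⟩
  rw [mulVec_smul, hv, smul_zero, l2_zero] at h2
  simpa using h2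

lemma ginv_isUnit_det {ℓ r : ℕ} {T : Matrix (Fin ℓ) (Fin r) K} (h : ginv T ≠ ⊤) :
    IsUnit (Tᴴ * T).det := by
  rw [isUnit_iff_ne_zero]
  intro h0
  obtain ⟨v, hv, hv0⟩ := Matrix.exists_mulVec_eq_zero_iff.mpr h0
  exact hv (ginv_injective h ((Matrix.conjTranspose_mul_self_mulVec_eq_zero T v).mp hv0))

lemma norm_pinv_le {ℓ r : ℕ} {T : Matrix (Fin ℓ) (Fin r) K} (h : ginv T ≠ ⊤)
    (w : Fin ℓ → K) (i : Fin r) :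
    ‖(((Tᴴ * T)⁻¹ * Tᴴ) *ᵥ w) i‖ₑ ≤ ginv T * ENNReal.ofReal (l2 w) := by
  set y := ((Tᴴ * T)⁻¹ * Tᴴ) *ᵥ w with hy
  have hTy : Tᴴ *ᵥ (T *ᵥ y) = Tᴴ *ᵥ w := by
    rw [hy, mulVec_mulVec, mulVec_mulVec, ← Matrix.mul_assoc,
      Matrix.mul_nonsing_inv _ (ginv_isUnit_det h), Matrix.one_mul]
  have hle : l2 (T *ᵥ y) ≤ l2 w := by
    have h1 : ((l2 (T *ᵥ y) ^ 2 : ℝ) : K) = star (T *ᵥ y) ⬝ᵥ w := by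
      rw [l2_sq_dot, star_mulVec, ← dotProduct_mulVec, hTy, dotProduct_mulVec]
    have h2 := norm_dot_le (T *ᵥ y) w
    rw [← h1, RCLike.norm_ofReal, abs_of_nonneg (by positivity), sq] at h2
    rcases (l2_nonneg (T *ᵥ y)).eq_or_lt with h3 | h3
    · rw [← h3]; exact l2_nonneg _
    · exact le_of_mul_le_mul_left h2 h3
  by_cases hyi : y i = 0
  · simp [hyi]
  have h2 : (ENNReal.ofReal (l2 (T *ᵥ ((y i)⁻¹ • y))))⁻¹ ≤ ginv T :=
    le_iSup (fun x : {x : Fin r → K // ∃ j, x j = 1} =>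
      (ENNReal.ofReal (l2 (T *ᵥ x.1)))⁻¹) ⟨(y i)⁻¹ • y, i, by simpa using inv_mul_cancel₀ hyi⟩
  set a := l2 (T *ᵥ ((y i)⁻¹ • y)) with ha
  have ha' : l2 (T *ᵥ y) = ‖y i‖ * a := by
    rw [ha, mulVec_smul, l2_smul, norm_inv, ← mul_assoc, mul_inv_cancel₀ (by simpa using hyi),
      one_mul]
  have hapos : 0 < a := by
    by_contra hcon
    have : a = 0 := le_antisymm (not_lt.mp hcon) (l2_nonneg _)
    rw [this] at h2
    simp at h2
    exact h h2
  calc ‖y i‖ₑ = ENNReal.ofReal (a⁻¹ * l2 (T *ᵥ y)) := by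
        rw [ha', mul_comm ‖y i‖, ← mul_assoc, inv_mul_cancel₀ hapos.ne', one_mul, ofReal_norm]
    _ = (ENNReal.ofReal a)⁻¹ * ENNReal.ofReal (l2 (T *ᵥ y)) := by
        rw [ENNReal.ofReal_mul (by positivity), ENNReal.ofReal_inv_of_pos hapos]
    _ ≤ _ := by gcongr

end LinAlg

set_option linter.unusedSectionVars false
section Gauss
variable {K : Type*} [RCLike K] [MeasurableSpace K] [BorelSpace K]

instance rclike_secondCountable : SecondCountableTopology K :=
  haveI := FiniteDimensional.proper_rclike K K
  inferInstance

lemma continuous_stdGaussianEntry : Continuous (stdGaussianEntry K) := by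
  unfold stdGaussianEntry
  split_ifs <;> fun_prop

/-- entry law -/
def gam (K : Type*) [RCLike K] [MeasurableSpace K] : Measure K :=
  Measure.map (stdGaussianEntry K) (Measure.pi fun _ : Bool => gaussianReal 0 1)

lemma measurable_stdGaussianEntry : Measurable (stdGaussianEntry K) :=
  continuous_stdGaussianEntry.measurable

instance gam_prob : IsProbabilityMeasure (gam K) :=
  Measure.isProbabilityMeasure_map measurable_stdGaussianEntry.aemeasurable

/-- matrix law as nested product -/
def gamMat (K : Type*) [RCLike K] [MeasurableSpace K] (r c : ℕ) : Measure (Fin r → Fin c → K) :=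
  Measure.pi fun _ : Fin r => Measure.pi fun _ : Fin c => gam K

instance gamMat_prob (r c : ℕ) : IsProbabilityMeasure (gamMat K r c) := by
  unfold gamMat; infer_instance

lemma gaussianMatrix_eq (r c : ℕ) : gaussianMatrix K r c = gamMat K r c := by
  unfold gaussianMatrix gamMat gam
  have h1 := Measure.pi_map_pi (ι := Fin c) (μ := fun _ => Measure.pi fun _ : Bool => gaussianReal 0 1)
    (f := fun _ => stdGaussianEntry K) (fun _ => measurable_stdGaussianEntry.aemeasurable)
  rw [← h1]
  have hm : Measurable (fun (x : Fin c → Bool → ℝ) i => stdGaussianEntry K (x i)) := by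
    refine measurable_pi_lambda _ fun i => measurable_stdGaussianEntry.comp (measurable_pi_apply i)
  haveI : IsProbabilityMeasure (Measure.map (fun (x : Fin c → Bool → ℝ) i => stdGaussianEntry K (x i)) (Measure.pi fun _ : Fin c =>
      Measure.pi fun _ : Bool => gaussianReal 0 1)) :=
    Measure.isProbabilityMeasure_map hm.aemeasurable
  have h2 := Measure.pi_map_pi (ι := Fin r) (μ := fun _ => Measure.pi fun _ : Fin c =>
      Measure.pi fun _ : Bool => gaussianReal 0 1)
    (f := fun _ (x : Fin c → Bool → ℝ) i => stdGaussianEntry K (x i)) (fun _ => hm.aemeasurable)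
  rw [← h2]
  rfl

/-- variance scale -/
def sig (K : Type*) [RCLike K] : ℝ := if (RCLike.I : K) = 0 then 1 else 1 / 2

lemma charFunDual_gam (a : K) :
    charFunDual (gam K) (InnerProductSpace.toDual ℝ K a)
      = Complex.exp (((-(sig K) * ‖a‖ ^ 2 / 2 : ℝ)) : ℂ) := by
  let E : (Bool → ℝ) →ₗ[ℝ] K :=
    { toFun := stdGaussianEntry K
      map_add' := by
        intro x y; unfold stdGaussianEntry; split_ifs
        · simp
        · simp; ring
      map_smul' := by
        intro x y; unfold stdGaussianEntry; split_ifs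
        · simp [Algebra.smul_def]
        · simp [Algebra.smul_def]; ring }
  have hE : gam K = Measure.map (LinearMap.toContinuousLinearMap E)
    (Measure.pi fun _ : Bool => gaussianReal 0 1) := rfl
  rw [hE, charFunDual_map, charFunDual_pi]
  have hg : ∀ L : StrongDual ℝ ℝ, charFunDual (gaussianReal 0 1) L
      = Complex.exp (((-(L 1)^2/2 : ℝ)) : ℂ) := by
    intro L
    have : L = (InnerProductSpace.toDual ℝ ℝ) (L 1) := by
      ext; simp
    rw [← charFun_toDual_symm_eq_charFunDual]
    have h2 : (InnerProductSpace.toDual ℝ ℝ).symm L = L 1 := by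
      rw [LinearIsometryEquiv.symm_apply_eq]; exact this
    rw [h2, charFun_gaussianReal]
    congr 1; push_cast; simp; ring
  simp_rw [hg]
  rw [← Complex.exp_sum]
  congr 1
  norm_cast
  have hs : ∀ b, E (Pi.single b 1) = stdGaussianEntry K (Pi.single b 1) := fun _ => rfl
  simp [hs, Fintype.sum_bool]
  have hnorm : ‖a‖ ^ 2 = RCLike.re a ^ 2 + RCLike.im a ^ 2 := by
    rw [← RCLike.normSq_eq_def', RCLike.normSq_apply]; ring
  have hin : ∀ z : K, inner ℝ a z = RCLike.re a * RCLike.re z + RCLike.im a * RCLike.im z := by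
    intro z; 
    rw [real_inner_eq_re_inner K, RCLike.inner_apply]; simp [RCLike.mul_re]; ring
  rw [hin, hin, hnorm]
  unfold stdGaussianEntry sig
  split_ifs with hI
  · have h0 : RCLike.im a = 0 := by
      have := RCLike.I_im a
      rw [hI] at this; simpa using this.symm
    simp [h0]
  · have hI1 : RCLike.im (RCLike.I : K) = 1 := RCLike.I_eq_zero_or_im_I_eq_one.resolve_left hI
    have h2 : (Real.sqrt 2) ^ 2 = 2 := by norm_num
    simp only [← RCLike.ofReal_inv, div_eq_mul_inv, RCLike.re_mul_ofReal, RCLike.im_mul_ofReal]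
    simp [hI1]
    have h3 : ((Real.sqrt 2)⁻¹) ^ 2 = 1/2 := by rw [inv_pow, h2]; norm_num
    simp only [mul_pow, h3]
    ring
end Gauss

set_option linter.unusedSectionVars false
section Rot
variable {K : Type*} [RCLike K] [MeasurableSpace K] [BorelSpace K]

instance matrix_borel {m n : ℕ} : BorelSpace (Matrix (Fin m) (Fin n) K) :=
  inferInstanceAs (BorelSpace (Fin m → Fin n → K))

/-- coefficients of a real functional on matrices -/
def dualCoef {n ℓ : ℕ} (L : StrongDual ℝ (Fin n → Fin ℓ → K)) : Matrix (Fin n) (Fin ℓ) K :=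
  fun i j => (InnerProductSpace.toDual ℝ K).symm
    ((L.comp (.single ℝ (fun _ : Fin n => Fin ℓ → K) i)).comp (.single ℝ (fun _ : Fin ℓ => K) j))

lemma dualCoef_inner {n ℓ : ℕ} (L : StrongDual ℝ (Fin n → Fin ℓ → K)) (i : Fin n) (j : Fin ℓ) (z : K) :
    inner ℝ (dualCoef L i j) z = L (Pi.single i (Pi.single j z)) := by
  simp [dualCoef]

lemma dualCoef_apply {n ℓ : ℕ} (L : StrongDual ℝ (Fin n → Fin ℓ → K)) (G : Fin n → Fin ℓ → K) :
    L G = ∑ i, ∑ j, inner ℝ (dualCoef L i j) (G i j) := by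
  simp_rw [dualCoef_inner, ← map_sum]
  congr 1
  ext i j
  simp [Finset.sum_apply, Pi.single_apply, apply_ite, ite_apply]

lemma charFunDual_gamMat {n ℓ : ℕ} (L : StrongDual ℝ (Fin n → Fin ℓ → K)) :
    charFunDual (gamMat K n ℓ) L = Complex.exp (((-(sig K) * frobSq (dualCoef L) / 2 : ℝ)) : ℂ) := by
  unfold gamMat
  rw [charFunDual_pi]
  have : ∀ i, charFunDual (Measure.pi fun _ : Fin ℓ => gam K)
      (L.comp (.single ℝ (fun _ : Fin n => Fin ℓ → K) i)) =
      Complex.exp (((-(sig K) * (∑ j, ‖dualCoef L i j‖ ^ 2) / 2 : ℝ)) : ℂ) := by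
    intro i
    rw [charFunDual_pi]
    have h2 : ∀ j, charFunDual (gam K) ((L.comp (.single ℝ (fun _ : Fin n => Fin ℓ → K) i)).comp
        (.single ℝ (fun _ : Fin ℓ => K) j)) =
        Complex.exp (((-(sig K) * ‖dualCoef L i j‖ ^ 2 / 2 : ℝ)) : ℂ) := by
      intro j
      rw [← charFunDual_gam]
      simp [dualCoef]
    simp_rw [h2]
    rw [← Complex.exp_sum]
    congr 1
    rw [← Complex.ofReal_sum, ← Finset.sum_div, ← Finset.mul_sum]
  simp_rw [this]
  rw [← Complex.exp_sum]
  congr 1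
  rw [← Complex.ofReal_sum, ← Finset.sum_div, ← Finset.mul_sum]
  rfl

lemma frobSq_unitary {n ℓ : ℕ} (U : Matrix (Fin n) (Fin n) K) (hU : Uᴴ * U = 1)
    (G : Matrix (Fin n) (Fin ℓ) K) : frobSq (U * G) = frobSq G := by
  have := frob_isometry U hU G
  unfold frob at this
  exact (Real.sqrt_inj (frobSq_nonneg _) (frobSq_nonneg _)).mp this

lemma unitary_mul {n : ℕ} {U : Matrix (Fin n) (Fin n) K} (hU : U ∈ Matrix.unitaryGroup (Fin n) K) :
    U * Uᴴ = 1 := Matrix.mem_unitaryGroup_iff.mp hU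
lemma unitary_mul' {n : ℕ} {U : Matrix (Fin n) (Fin n) K} (hU : U ∈ Matrix.unitaryGroup (Fin n) K) :
    Uᴴ * U = 1 := Matrix.mem_unitaryGroup_iff'.mp hU

lemma gamMat_rot {n ℓ : ℕ} (U : Matrix (Fin n) (Fin n) K) (hU : U ∈ Matrix.unitaryGroup (Fin n) K) :
    Measure.map (fun (G : Fin n → Fin ℓ → K) i j => (U * Matrix.of G) i j) (gamMat K n ℓ)
      = gamMat K n ℓ := by
  let Φ₀ : (Fin n → Fin ℓ → K) →ₗ[ℝ] (Fin n → Fin ℓ → K) :=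
    { toFun := fun G => (U * Matrix.of G : Matrix (Fin n) (Fin ℓ) K)
      map_add' := by
        intro x y; exact Matrix.mul_add U (Matrix.of x) (Matrix.of y)
      map_smul' := by
        intro c x; exact Matrix.mul_smul U c (Matrix.of x) }
  let Φ : (Fin n → Fin ℓ → K) →L[ℝ] (Fin n → Fin ℓ → K) := LinearMap.toContinuousLinearMap Φ₀
  change Measure.map Φ (gamMat K n ℓ) = gamMat K n ℓ
  have : IsProbabilityMeasure (Measure.map Φ (gamMat K n ℓ)) :=
    Measure.isProbabilityMeasure_map Φ.continuous.measurable.aemeasurable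
  apply Measure.ext_of_charFunDual
  ext L
  rw [charFunDual_map, charFunDual_gamMat, charFunDual_gamMat]
  have key : dualCoef (L.comp Φ) = Uᴴ * dualCoef L := by
    ext k j
    refine ext_inner_right ℝ fun z => ?_
    rw [dualCoef_inner]
    have hval : ∀ i j', Φ (Pi.single k (Pi.single j z)) i j' = if j' = j then U i k * z else 0 := by
      intro i j'
      change (U * Matrix.of (Pi.single k (Pi.single j z) : Fin n → Fin ℓ → K)) i j' = _
      rw [Matrix.mul_apply, Finset.sum_eq_single k]
      · by_cases h : j' = j
        · subst h; simp
        · simp [h]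
      · intro b _ hb; simp [hb]
      · simp
    rw [ContinuousLinearMap.comp_apply, dualCoef_apply]
    simp_rw [hval]
    simp only [Matrix.mul_apply, sum_inner]
    refine Finset.sum_congr rfl fun i _ => ?_
    rw [Finset.sum_eq_single j]
    · simp only [if_true, real_inner_eq_re_inner K, RCLike.inner_apply, conjTranspose_apply,
        map_mul, RCLike.star_def, RCLike.conj_conj]
      congr 1; ring
    · intro b _ hb; simp [hb]
    · simp
  rw [key, frobSq_unitary]
  rw [conjTranspose_conjTranspose]; exact unitary_mul hU

lemma gam_vec_rot {n : ℕ} (U : Matrix (Fin n) (Fin n) K) (hU : U ∈ Matrix.unitaryGroup (Fin n) K) :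
    Measure.map (fun y : Fin n → K => U *ᵥ y) (Measure.pi fun _ : Fin n => gam K)
      = Measure.pi fun _ : Fin n => gam K := by
  have h0 : (Measure.pi fun _ : Fin n => gam K) =
      Measure.map (fun (G : Fin n → Fin 1 → K) i => G i 0) (gamMat K n 1) := by
    unfold gamMat
    have he : Measure.map (fun x : Fin 1 → K => x 0) (Measure.pi fun _ : Fin 1 => gam K) = gam K :=
      (measurePreserving_eval (fun _ : Fin 1 => gam K) 0).map_eq
    have : IsProbabilityMeasure (Measure.map (fun x : Fin 1 → K => x 0) (Measure.pi fun _ : Fin 1 => gam K)) := by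
      rw [he]; infer_instance
    have := Measure.pi_map_pi (ι := Fin n) (μ := fun _ => Measure.pi fun _ : Fin 1 => gam K)
      (f := fun _ (x : Fin 1 → K) => x 0) (fun _ => (measurable_pi_apply 0).aemeasurable)
    rw [this, he]
  have hc : Measurable (fun (G : Fin n → Fin 1 → K) i => G i 0) := by fun_prop
  have hU1 : Measurable (fun y : Fin n → K => U *ᵥ y) :=
    (Continuous.matrix_mulVec continuous_const continuous_id).measurable
  have hU2 : Measurable (fun (G : Fin n → Fin 1 → K) i j => (U * Matrix.of G) i j) := by
    have : Continuous (fun G : Matrix (Fin n) (Fin 1) K => U * G) := by fun_prop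
    exact this.measurable
  conv_lhs => rw [h0]
  rw [Measure.map_map hU1 hc]
  conv_rhs => rw [h0, ← gamMat_rot U hU]
  rw [Measure.map_map hc hU2]
  rfl
end Rot

set_option linter.unusedSectionVars false
section Moments

lemma lintegral_pi_prod' {ι : Type*} [Fintype ι] {X : ι → Type*} [∀ i, MeasurableSpace (X i)]
    (μ : ∀ i, Measure (X i)) [∀ i, IsProbabilityMeasure (μ i)] (w : ∀ i, X i → ℝ≥0∞)
    (hw : ∀ i, Measurable (w i)) :
    ∫⁻ y, ∏ i, w i (y i) ∂(Measure.pi μ) = ∏ i, ∫⁻ z, w i z ∂(μ i) := by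
  have h := lintegral_prod_eq_prod_lintegral_of_indepFun (μ := Measure.pi μ) Finset.univ
    (fun i (y : ∀ i, X i) => w i (y i))
    (iIndepFun_pi (X := w) (fun i => (hw i).aemeasurable)) (fun i => (hw i).comp (measurable_pi_apply i))
  rw [h]
  refine Finset.prod_congr rfl fun i _ => ?_
  exact (measurePreserving_eval μ i).lintegral_comp (hw i)

lemma gaussian_neg_moment {a : ℝ} (ha0 : 0 < a) (ha : a < 1) :
    ∫⁻ x, ‖x‖ₑ ^ (-a) ∂(gaussianReal 0 1) < ⊤ := by
  rw [gaussianReal_of_var_ne_zero 0 one_ne_zero,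
    lintegral_withDensity_eq_lintegral_mul _ (measurable_gaussianPDF 0 1) (by fun_prop)]
  have h1 : IntegrableOn (fun x : ℝ => x ^ (-a) * Real.exp (-(1/2) * x ^ 2)) (Set.Ioi 0) :=
    integrableOn_rpow_mul_exp_neg_mul_sq (by norm_num) (by linarith)
  have hab : Integrable (fun x : ℝ => |x| ^ (-a) * Real.exp (-(1/2) * |x| ^ 2)) := by
    have h3 : IntegrableOn (fun x : ℝ => |x| ^ (-a) * Real.exp (-(1/2) * |x| ^ 2)) (Set.Ioi 0) :=
      h1.congr_fun (fun x hx => by simp only [abs_of_pos (Set.mem_Ioi.mp hx)]) measurableSet_Ioi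
    have h4 : IntegrableOn (fun x : ℝ => |x| ^ (-a) * Real.exp (-(1/2) * |x| ^ 2)) (Set.Iio 0) := by
      have := (integrable_indicator_iff measurableSet_Ioi).mpr h3
      have h5 := this.comp_neg
      rw [← integrable_indicator_iff measurableSet_Iio]
      refine h5.congr (ae_of_all _ fun x => ?_)
      simp [Set.indicator, abs_neg]
    have h6 := h4.union h3
    rw [← integrableOn_univ, ← integrableOn_congr_set_ae (s := Set.Iio 0 ∪ Set.Ioi 0)]
    · exact h6
    · rw [ae_eq_univ]; simp
  have h2 := hab.const_mul ((Real.sqrt (2 * Real.pi * (1:ℝ)))⁻¹)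
  refine lt_of_le_of_lt (le_of_eq ?_) h2.2
  refine lintegral_congr_ae ?_
  have h0 : ∀ᵐ x : ℝ, x ≠ 0 := by simp [ae_iff]
  filter_upwards [h0] with x hx
  rw [Pi.mul_apply, gaussianPDF, gaussianPDFReal, ← ofReal_norm, ← ofReal_norm,
    ENNReal.ofReal_rpow_of_pos (by simpa using hx), ← ENNReal.ofReal_mul (by positivity)]
  congr 1
  have hpos : 0 ≤ (Real.sqrt (2 * Real.pi * (1:ℝ)))⁻¹ *
      (|x| ^ (-a) * Real.exp (-(1/2) * |x| ^ 2)) := by positivity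
  rw [Real.norm_of_nonneg hpos, Real.norm_eq_abs]
  simp
  ring_nf

lemma gaussian_sq_moment : ∫⁻ x, ENNReal.ofReal (x ^ 2) ∂(gaussianReal 0 1) < ⊤ := by
  have := (memLp_id_gaussianReal (μ := 0) (v := 1) 2).integrable_sq
  exact this.lintegral_lt_top

variable {K : Type*} [RCLike K] [MeasurableSpace K] [BorelSpace K]

lemma norm_entry_sq (hI : (RCLike.I : K) ≠ 0) (v : Bool → ℝ) :
    ‖stdGaussianEntry K v‖ ^ 2 = (v false ^ 2 + v true ^ 2) / 2 := by
  have hI1 : RCLike.im (RCLike.I : K) = 1 := RCLike.I_eq_zero_or_im_I_eq_one.resolve_left hI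
  have h2 : (Real.sqrt 2) ^ 2 = 2 := by norm_num
  unfold stdGaussianEntry
  rw [if_neg hI, norm_div, div_pow, RCLike.norm_ofReal, sq_abs, h2, ← RCLike.normSq_eq_def',
    RCLike.normSq_apply]
  simp [hI1]
  ring

lemma gam_sq_moment : ∫⁻ z, ENNReal.ofReal (‖z‖ ^ 2) ∂(gam K) < ⊤ := by
  unfold gam
  rw [lintegral_map (by fun_prop) measurable_stdGaussianEntry]
  have hb : ∀ b : Bool, ∫⁻ v : Bool → ℝ, ENNReal.ofReal ((v b) ^ 2)
      ∂(Measure.pi fun _ : Bool => gaussianReal 0 1) < ⊤ := by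
    intro b
    have := (measurePreserving_eval (fun _ : Bool => gaussianReal 0 1) b).lintegral_comp
      (f := fun x => ENNReal.ofReal (x ^ 2)) (by fun_prop)
    simp only [Function.eval] at this
    rw [this]; exact gaussian_sq_moment
  refine lt_of_le_of_lt (lintegral_mono (g := fun v : Bool → ℝ => ENNReal.ofReal ((v false) ^ 2)
    + ENNReal.ofReal ((v true) ^ 2)) fun v => ?_) ?_
  · show _ ≤ ENNReal.ofReal ((v false) ^ 2) + ENNReal.ofReal ((v true) ^ 2)
    rw [← ENNReal.ofReal_add (by positivity) (by positivity)]
    apply ENNReal.ofReal_le_ofReal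
    by_cases hI : (RCLike.I : K) = 0
    · simp [stdGaussianEntry, hI]; positivity
    · rw [norm_entry_sq hI]; nlinarith [sq_nonneg (v false), sq_nonneg (v true)]
  · rw [lintegral_add_left (by fun_prop)]
    exact ENNReal.add_lt_top.mpr ⟨hb _, hb _⟩

/-- number of free coordinates: 3 in the real case, 2 in the complex case -/
def nfree (K : Type*) [RCLike K] : ℕ := if (RCLike.I : K) = 0 then 3 else 2

lemma gam_neg_moment : ∫⁻ z, ‖z‖ₑ ^ (-(2 / (nfree K : ℝ))) ∂(gam K) < ⊤ := by
  unfold gam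
  rw [lintegral_map (by fun_prop) measurable_stdGaussianEntry]
  by_cases hI : (RCLike.I : K) = 0
  · have := (measurePreserving_eval (fun _ : Bool => gaussianReal 0 1) false).lintegral_comp
      (f := fun x => ‖x‖ₑ ^ (-(2 / (3:ℝ)))) (by fun_prop)
    simp only [Function.eval] at this
    have h2 := gaussian_neg_moment (a := 2/3) (by norm_num) (by norm_num)
    rw [← this] at h2
    convert h2 using 4 with v
    · rw [stdGaussianEntry, if_pos hI, ← ofReal_norm, ← ofReal_norm, RCLike.norm_ofReal]; rfl
    · simp [nfree, hI]
  · have h := lintegral_pi_prod' (fun _ : Bool => gaussianReal 0 1)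
      (fun _ x => ‖x‖ₑ ^ (-(1 / (2:ℝ)))) (fun _ => by fun_prop)
    have h2 := gaussian_neg_moment (a := 1/2) (by norm_num) (by norm_num)
    have h3 : ∏ i : Bool, ∫⁻ z, ‖z‖ₑ ^ (-(1 / (2:ℝ))) ∂(gaussianReal 0 1) < ⊤ :=
      ENNReal.prod_lt_top fun _ _ => h2
    rw [← h] at h3
    refine lt_of_le_of_lt (lintegral_mono fun v => ?_) h3
    have hn : (-(2 / (nfree K : ℝ))) = -1 := by simp [nfree, hI]
    rw [hn, Fintype.prod_bool]
    have h5 : ‖v true‖ₑ * ‖v false‖ₑ ≤ ‖stdGaussianEntry K v‖ₑ ^ 2 := by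
      rw [← ofReal_norm, ← ofReal_norm, ← ofReal_norm, ← ENNReal.ofReal_mul (by positivity),
        ← ENNReal.ofReal_pow (by positivity), norm_entry_sq hI]
      apply ENNReal.ofReal_le_ofReal
      simp only [Real.norm_eq_abs]
      nlinarith [sq_nonneg (|v true| - |v false|), sq_abs (v true), sq_abs (v false)]
    have h6 : (‖v true‖ₑ * ‖v false‖ₑ) ^ (1 / (2:ℝ)) ≤ ‖stdGaussianEntry K v‖ₑ := by
      refine (ENNReal.rpow_le_rpow h5 (by norm_num)).trans (le_of_eq ?_)
      rw [← ENNReal.rpow_natCast, ← ENNReal.rpow_mul]; norm_num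
    rw [ENNReal.rpow_neg_one]
    refine (ENNReal.inv_le_inv.mpr h6).trans (le_of_eq ?_)
    rw [ENNReal.mul_rpow_of_nonneg _ _ (by norm_num), ENNReal.rpow_neg, ENNReal.rpow_neg,
      ENNReal.mul_inv]
    · right; exact (ENNReal.rpow_lt_top_of_nonneg (by norm_num) (by simp)).ne
    · left; exact (ENNReal.rpow_lt_top_of_nonneg (by norm_num) (by simp)).ne

lemma gamMat_frobSq (n ℓ : ℕ) :
    ∫⁻ G : Fin n → Fin ℓ → K, ENNReal.ofReal (frobSq (Matrix.of G)) ∂(gamMat K n ℓ) < ⊤ := by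
  have h1 : ∀ G : Fin n → Fin ℓ → K, ENNReal.ofReal (frobSq (Matrix.of G))
      = ∑ i, ∑ j, ENNReal.ofReal (‖G i j‖ ^ 2) := by
    intro G
    unfold frobSq
    rw [ENNReal.ofReal_sum_of_nonneg fun _ _ => by positivity]
    refine Finset.sum_congr rfl fun i _ => ?_
    rw [ENNReal.ofReal_sum_of_nonneg fun _ _ => by positivity]
    rfl
  simp_rw [h1]
  rw [lintegral_finsetSum _ (fun i _ => by fun_prop)]
  refine ENNReal.sum_lt_top.mpr fun i _ => ?_
  rw [lintegral_finsetSum _ (fun i _ => by fun_prop)]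
  refine ENNReal.sum_lt_top.mpr fun j _ => ?_
  have e1 := (measurePreserving_eval (fun _ : Fin n => Measure.pi fun _ : Fin ℓ => gam K) i).lintegral_comp
      (f := fun x => ENNReal.ofReal (‖x j‖ ^ 2)) (by fun_prop)
  have e2 := (measurePreserving_eval (fun _ : Fin ℓ => gam K) j).lintegral_comp
      (f := fun x => ENNReal.ofReal (‖x‖ ^ 2)) (by fun_prop)
  simp only [Function.eval] at e1 e2
  unfold gamMat
  rw [e1, e2]
  exact gam_sq_moment
end Moments

set_option linter.unusedSectionVars false
section Key
variable {K : Type*} [RCLike K]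

/-- partial version of `ginv` -/
def gpart {m r : ℕ} (j : Fin r) (T : Matrix (Fin m) (Fin r) K) : ℝ≥0∞ :=
  ⨆ x : {x : Fin r → K // x j = 1}, (ENNReal.ofReal (l2 (T *ᵥ x.1)))⁻¹

lemma ginv_le_sum {m r : ℕ} (T : Matrix (Fin m) (Fin r) K) : ginv T ≤ ∑ j, gpart j T := by
  unfold ginv
  refine iSup_le fun ⟨x, j, hj⟩ => ?_
  refine le_trans ?_ (Finset.single_le_sum (f := fun j => gpart j T) (fun _ _ => zero_le)
    (Finset.mem_univ j))
  exact le_iSup (fun x : {x : Fin r → K // x j = 1} => (ENNReal.ofReal (l2 (T *ᵥ x.1)))⁻¹) ⟨x, hj⟩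

/-- matrix whose columns are conjugates of rows of `G` -/
def colM {n ℓ r : ℕ} (c : Fin r → Fin n) (G : Fin n → Fin ℓ → K) : Matrix (Fin ℓ) (Fin r) K :=
  Matrix.of fun i k => star (G (c k) i)

lemma l2_star {m : ℕ} (v : Fin m → K) : l2 (star v) = l2 v := by
  have := l2_sq v
  have h2 := l2_sq (star v)
  simp only [Pi.star_apply, norm_star] at h2
  rw [← this] at h2
  exact (pow_left_inj₀ (l2_nonneg _) (l2_nonneg _) two_ne_zero).mp h2

lemma gpart_bound {n ℓ r : ℕ} (c : Fin r → Fin n) (j : Fin r) (G : Fin n → Fin ℓ → K)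
    (V : Matrix (Fin ℓ) (Fin ℓ) K) (hV : Vᴴ * V = 1) (i : Fin ℓ)
    (hz : ∀ k, k ≠ j → (V *ᵥ G (c k)) i = 0) (x : Fin r → K) (hx : x j = 1) :
    ‖(V *ᵥ G (c j)) i‖ ≤ l2 (colM c G *ᵥ x) := by
  have h1 : star (colM c G *ᵥ x) = ∑ k, star (x k) • G (c k) := by
    ext a
    simp [colM, Matrix.mulVec, dotProduct, mul_comm]
  have h2 : (V *ᵥ (star (colM c G *ᵥ x))) i = (V *ᵥ G (c j)) i := by
    rw [h1, Matrix.mulVec_sum, Finset.sum_apply, Finset.sum_eq_single j]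
    · simp [hx]
    · intro k _ hk
      rw [Matrix.mulVec_smul, Pi.smul_apply, hz k hk, smul_zero]
    · simp
  rw [← h2, ← l2_star (colM c G *ᵥ x), ← l2_isometry V hV]
  exact norm_le_l2 _ _

variable [MeasurableSpace K] [BorelSpace K]

lemma measurable_ginv {m r : ℕ} : Measurable (ginv : Matrix (Fin m) (Fin r) K → ℝ≥0∞) := by
  refine LowerSemicontinuous.measurable ?_
  unfold ginv
  refine lowerSemicontinuous_iSup fun x => Continuous.lowerSemicontinuous ?_
  refine (continuous_inv (G := ℝ≥0∞)).comp (ENNReal.continuous_ofReal.comp (l2_continuous.comp ?_))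
  exact Continuous.matrix_mulVec continuous_id continuous_const

lemma measurable_gpart {m r : ℕ} (j : Fin r) :
    Measurable (gpart j : Matrix (Fin m) (Fin r) K → ℝ≥0∞) := by
  refine LowerSemicontinuous.measurable ?_
  unfold gpart
  refine lowerSemicontinuous_iSup fun x => Continuous.lowerSemicontinuous ?_
  refine (continuous_inv (G := ℝ≥0∞)).comp (ENNReal.continuous_ofReal.comp (l2_continuous.comp ?_))
  exact Continuous.matrix_mulVec continuous_id continuous_const

lemma measurable_colM {n ℓ r : ℕ} (c : Fin r → Fin n) :
    Measurable (colM c : (Fin n → Fin ℓ → K) → Matrix (Fin ℓ) (Fin r) K) := by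
  refine measurable_pi_iff.mpr fun i => measurable_pi_iff.mpr fun k => ?_
  have : Continuous (fun G : Fin n → Fin ℓ → K => star (G (c k) i)) := by fun_prop
  exact this.measurable

/-- constant -/
def cst (K : Type*) [RCLike K] [MeasurableSpace K] [BorelSpace K] (ℓ : ℕ) : ℝ≥0∞ :=
  (1 + ∫⁻ z, ‖z‖ₑ ^ (-(2 / (nfree K : ℝ))) ∂(gam K)) ^ ℓ

lemma cst_lt_top (ℓ : ℕ) : cst K ℓ < ⊤ :=
  ENNReal.pow_lt_top (ENNReal.add_lt_top.mpr ⟨by simp, gam_neg_moment⟩)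

lemma nfree_pos : 0 < nfree K := by unfold nfree; split_ifs <;> norm_num

lemma gpart_row {n ℓ r : ℕ} (c : Fin r → Fin n) (hc : Function.Injective c)
    (hN : r + nfree K ≤ ℓ + 1) (j : Fin r) (G : Fin n → Fin ℓ → K) :
    ∫⁻ y, (gpart j (colM c (Function.update G (c j) y))) ^ 2 ∂(Measure.pi fun _ : Fin ℓ => gam K)
      ≤ cst K ℓ := by
  obtain ⟨r', rfl⟩ : ∃ r', r = r' + 1 := ⟨r - 1, by have := j.2; omega⟩
  have hNp := nfree_pos (K := K)
  obtain ⟨V, hV, hz⟩ := exists_qr (K := K) (n := ℓ) (m := r') (by omega)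
    (fun k => G (c (j.succAbove k)))
  let S : Finset (Fin ℓ) := Finset.univ.filter fun i => r' ≤ i.val ∧ i.val < r' + nfree K
  have hS : S.card = nfree K := by
    have : S = (Finset.univ : Finset (Fin (nfree K))).image
        (fun a => (⟨r' + a.val, by omega⟩ : Fin ℓ)) := by
      ext i
      simp only [S, Finset.mem_filter, Finset.mem_univ, true_and, Finset.mem_image]
      constructor
      · intro h; exact ⟨⟨i.val - r', by omega⟩, by ext; simp; omega⟩
      · rintro ⟨a, rfl⟩; simp
    rw [this, Finset.card_image_of_injective]
    · simp
    · intro a b h; simp at h; ext; omega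
  let w : Fin ℓ → K → ℝ≥0∞ := fun i z => if i ∈ S then ‖z‖ₑ ^ (-(2 / (nfree K : ℝ))) else 1
  have hw : ∀ i, Measurable (w i) := by
    intro i; by_cases hi : i ∈ S
    · simp only [w, hi, if_true]; fun_prop
    · simp only [w, hi, if_false]; fun_prop
  have hpt : ∀ y, (gpart j (colM c (Function.update G (c j) y))) ^ 2 ≤ ∏ i, w i ((V *ᵥ y) i) := by
    intro y
    have hprod : ∏ i, w i ((V *ᵥ y) i) =
        ((∏ i ∈ S, ‖(V *ᵥ y) i‖ₑ ^ (1 / (nfree K : ℝ)))⁻¹) ^ 2 := by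
      rw [Finset.prod_ite_mem, Finset.univ_inter, ENNReal.prod_inv_distrib, ← Finset.prod_pow]
      · refine Finset.prod_congr rfl fun i _ => ?_
        rw [← ENNReal.rpow_neg, ← ENNReal.rpow_natCast, ← ENNReal.rpow_mul]
        congr 1; push_cast; ring
      · intro a _ b _ _
        right
        exact (ENNReal.rpow_lt_top_of_nonneg (by positivity) (by simp)).ne
    rw [hprod]
    gcongr
    unfold gpart
    refine iSup_le fun ⟨x, hx⟩ => ?_
    rw [ENNReal.inv_le_inv]
    calc ∏ i ∈ S, ‖(V *ᵥ y) i‖ₑ ^ (1 / (nfree K : ℝ))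
        ≤ ∏ i ∈ S, (ENNReal.ofReal (l2 (colM c (Function.update G (c j) y) *ᵥ x)))
            ^ (1 / (nfree K : ℝ)) := by
          refine Finset.prod_le_prod' fun i hi => ?_
          refine ENNReal.rpow_le_rpow ?_ (by positivity)
          rw [← ofReal_norm]
          refine ENNReal.ofReal_le_ofReal ?_
          have := gpart_bound c j (Function.update G (c j) y) V (unitary_mul' hV) i ?_ x hx
          · simpa using this
          · intro k hk
            obtain ⟨a, rfl⟩ := Fin.exists_succAbove_eq hk
            rw [Function.update_of_ne (fun h => hk (hc h))]
            refine hz a i ?_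
            simp only [S, Finset.mem_filter] at hi; exact hi.2.1
      _ = _ := by
          rw [Finset.prod_const, hS, ← ENNReal.rpow_natCast, ← ENNReal.rpow_mul,
            one_div_mul_cancel (by exact_mod_cast hNp.ne'), ENNReal.rpow_one]
  calc _ ≤ ∫⁻ y, ∏ i, w i ((V *ᵥ y) i) ∂(Measure.pi fun _ : Fin ℓ => gam K) := lintegral_mono hpt
    _ = ∫⁻ y, ∏ i, w i (y i) ∂(Measure.pi fun _ : Fin ℓ => gam K) := by
        conv_rhs => rw [← gam_vec_rot V hV]
        rw [lintegral_map]
        · exact Finset.measurable_prod _ fun i _ => (hw i).comp (measurable_pi_apply i)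
        · exact (Continuous.matrix_mulVec continuous_const continuous_id).measurable
    _ = ∏ i, ∫⁻ z, w i z ∂(gam K) := lintegral_pi_prod' _ w hw
    _ ≤ ∏ i : Fin ℓ, (1 + ∫⁻ z, ‖z‖ₑ ^ (-(2 / (nfree K : ℝ))) ∂(gam K)) := by
        refine Finset.prod_le_prod' fun i _ => ?_
        by_cases hi : i ∈ S
        · simp only [w, hi, if_true]; exact le_add_self
        · simp only [w, hi, if_false]; simp
    _ = cst K ℓ := by simp [cst]

lemma gpart_int {n ℓ r : ℕ} (c : Fin r → Fin n) (hc : Function.Injective c)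
    (hN : r + nfree K ≤ ℓ + 1) (j : Fin r) :
    ∫⁻ G : Fin n → Fin ℓ → K, (gpart j (colM c G)) ^ 2 ∂(gamMat K n ℓ) ≤ cst K ℓ := by
  have h := lintegral_le_of_lmarginal_le (μ := fun _ : Fin n => Measure.pi fun _ : Fin ℓ => gam K)
    {c j} (f := fun G => (gpart j (colM c G)) ^ 2) (g := fun _ => cst K ℓ)
    (((measurable_gpart j).comp (measurable_colM c)).pow_const 2) measurable_const ?_
  · unfold gamMat
    simpa using h
  · intro G
    rw [lmarginal_singleton, lmarginal_singleton]
    simpa using gpart_row c hc hN j G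

lemma key_gauss {n ℓ r : ℕ} (c : Fin r → Fin n) (hc : Function.Injective c)
    (hN : r + nfree K ≤ ℓ + 1) :
    ∫⁻ G : Fin n → Fin ℓ → K, ENNReal.ofReal (1 + frob (Matrix.of G)) * ginv (colM c G)
      ∂(gamMat K n ℓ) < ⊤ := by
  have hmf : Measurable (fun G : Fin n → Fin ℓ → K => ENNReal.ofReal (frobSq (Matrix.of G))) := by
    unfold frobSq; simp only [Matrix.of_apply]; fun_prop
  have hpt : ∀ G : Fin n → Fin ℓ → K, ENNReal.ofReal (1 + frob (Matrix.of G)) * ginv (colM c G)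
      ≤ ∑ j, (2 * (1 + ENNReal.ofReal (frobSq (Matrix.of G))) + gpart j (colM c G) ^ 2) := by
    intro G
    refine (mul_le_mul_right (ginv_le_sum _) _).trans ?_
    rw [Finset.mul_sum]
    refine Finset.sum_le_sum fun j _ => ?_
    set a := ENNReal.ofReal (1 + frob (Matrix.of G)) with ha
    set b := gpart j (colM c G)
    have h1 : a * b ≤ a ^ 2 + b ^ 2 := by
      rcases le_total a b with h | h
      · calc a * b ≤ b * b := by gcongr
          _ ≤ _ := by rw [← sq]; exact le_add_self
      · calc a * b ≤ a * a := by gcongr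
          _ ≤ _ := by rw [← sq]; exact le_self_add
    refine h1.trans (add_le_add_left ?_ _)
    rw [ha, ← ENNReal.ofReal_pow (by have := frob_nonneg (Matrix.of G); linarith),
      ← ENNReal.ofReal_one, ← ENNReal.ofReal_add zero_le_one (frobSq_nonneg _),
      ← ENNReal.ofReal_ofNat, ← ENNReal.ofReal_mul (by norm_num)]
    apply ENNReal.ofReal_le_ofReal
    have : frob (Matrix.of G) ^ 2 = frobSq (Matrix.of G) := Real.sq_sqrt (frobSq_nonneg _)
    nlinarith [sq_nonneg (1 - frob (Matrix.of G))]
  refine lt_of_le_of_lt (lintegral_mono hpt) ?_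
  have hm : ∀ j, Measurable fun G : Fin n → Fin ℓ → K => gpart j (colM c G) ^ 2 :=
    fun j => (((measurable_gpart j).comp (measurable_colM c)).pow_const 2)
  rw [lintegral_finsetSum _ (fun i _ => by have := hm i; fun_prop)]
  refine ENNReal.sum_lt_top.mpr fun j _ => ?_
  rw [lintegral_add_right _ (hm j), lintegral_const_mul _ (by fun_prop),
    lintegral_add_left (by fun_prop)]
  refine ENNReal.add_lt_top.mpr ⟨ENNReal.mul_lt_top (by simp) (ENNReal.add_lt_top.mpr
    ⟨by simp, gamMat_frobSq n ℓ⟩), (gpart_int c hc hN j).trans_lt (cst_lt_top ℓ)⟩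
end Key

set_option linter.unusedSectionVars false
section HaarPart
variable {K : Type*} [RCLike K] [MeasurableSpace K] [BorelSpace K]

lemma compact_unitaryGroup (n : ℕ) :
    IsCompact (Matrix.unitaryGroup (Fin n) K : Set (Matrix (Fin n) (Fin n) K)) := by
  have := FiniteDimensional.proper_rclike K K
  have h1 : IsCompact (Set.univ.pi fun _ : Fin n => Set.univ.pi fun _ : Fin n =>
      Metric.closedBall (0:K) 1) :=
    isCompact_univ_pi fun _ => isCompact_univ_pi fun _ => isCompact_closedBall 0 1
  refine IsCompact.of_isClosed_subset (X := Matrix (Fin n) (Fin n) K) h1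
    (isClosed_unitary (R := Matrix (Fin n) (Fin n) K)) ?_
  intro U hU i _ j _
  rw [mem_closedBall_zero_iff]
  exact entry_norm_bound_of_unitary hU i j

lemma exists_haar (n : ℕ) : ∃ η : Measure (Matrix (Fin n) (Fin n) K), IsProbabilityMeasure η ∧
    (∀ᵐ O ∂η, O ∈ Matrix.unitaryGroup (Fin n) K) ∧
    ∀ V ∈ Matrix.unitaryGroup (Fin n) K, Measure.map (fun O => V * O) η = η := by
  let H := unitary (Matrix (Fin n) (Fin n) K)
  let : MeasurableSpace H := borel H
  have : BorelSpace H := ⟨rfl⟩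
  have : CompactSpace H := isCompact_iff_compactSpace.mp (compact_unitaryGroup (K := K) n)
  let ν : Measure H := Measure.haarMeasure (⊤ : TopologicalSpace.PositiveCompacts H)
  have hval : Measurable (fun g : H => (g : Matrix (Fin n) (Fin n) K)) :=
    continuous_subtype_val.measurable
  have hp : IsProbabilityMeasure ν := ⟨by
    have := Measure.haarMeasure_self (K₀ := (⊤ : TopologicalSpace.PositiveCompacts H))
    simpa using this⟩
  refine ⟨Measure.map (fun g : H => (g : Matrix (Fin n) (Fin n) K)) ν,
    Measure.isProbabilityMeasure_map hval.aemeasurable, ?_, ?_⟩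
  · have hms : MeasurableSet {O : Matrix (Fin n) (Fin n) K | O ∈ Matrix.unitaryGroup (Fin n) K} :=
      (compact_unitaryGroup (K := K) n).isClosed.measurableSet
    rw [ae_map_iff hval.aemeasurable hms]
    exact ae_of_all _ fun g => g.2
  · intro V hV
    have hVm : Measurable fun O : Matrix (Fin n) (Fin n) K => V * O :=
      (continuous_const.mul continuous_id).measurable
    rw [Measure.map_map hVm hval]
    have h := map_mul_left_eq_self ν (⟨V, hV⟩ : H)
    conv_rhs => rw [← h]
    have hm2 : Measurable fun x : H => (⟨V, hV⟩ : H) * x :=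
      (continuous_const.mul continuous_id).measurable
    rw [Measure.map_map hval hm2]
    rfl

lemma measurable_constMul {n m ℓ : ℕ} (U : Matrix (Fin m) (Fin n) K) :
    Measurable fun Z : Matrix (Fin n) (Fin ℓ) K => U * Z :=
  (Continuous.matrix_mul continuous_const continuous_id).measurable

/-- averaging over the unitary group -/
lemma avg_unitary {n ℓ : ℕ} (lam : Measure (Matrix (Fin n) (Fin ℓ) K)) [IsProbabilityMeasure lam]
    (hrot : ∀ U ∈ Matrix.unitaryGroup (Fin n) K, Measure.map (fun Z => U * Z) lam = lam)
    (η : Measure (Matrix (Fin n) (Fin n) K)) [IsProbabilityMeasure η]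
    (hη : ∀ᵐ O ∂η, O ∈ Matrix.unitaryGroup (Fin n) K)
    (F : Matrix (Fin n) (Fin ℓ) K → ℝ≥0∞) (hF : Measurable F) :
    ∫⁻ Z, ∫⁻ O, F (Oᴴ * Z) ∂η ∂lam = ∫⁻ Z, F Z ∂lam := by
  have : SecondCountableTopology (Matrix (Fin n) (Fin ℓ) K) :=
    inferInstanceAs (SecondCountableTopology (Fin n → Fin ℓ → K))
  have : SecondCountableTopology (Matrix (Fin n) (Fin n) K) :=
    inferInstanceAs (SecondCountableTopology (Fin n → Fin n → K))
  have hc : Continuous (fun q : Matrix (Fin n) (Fin ℓ) K × Matrix (Fin n) (Fin n) K =>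
      q.2ᴴ * q.1) := (continuous_snd.matrix_conjTranspose).matrix_mul continuous_fst
  have hFm : AEMeasurable (Function.uncurry fun (Z : Matrix (Fin n) (Fin ℓ) K)
      (O : Matrix (Fin n) (Fin n) K) => F (Oᴴ * Z)) (lam.prod η) :=
    (hF.comp hc.measurable).aemeasurable
  rw [lintegral_lintegral_swap hFm]
  calc ∫⁻ O, ∫⁻ Z, F (Oᴴ * Z) ∂lam ∂η = ∫⁻ _O, ∫⁻ Z, F Z ∂lam ∂η := by
        refine lintegral_congr_ae ?_
        filter_upwards [hη] with O hO
        have hO' : Oᴴ ∈ Matrix.unitaryGroup (Fin n) K := Unitary.star_mem hO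
        conv_rhs => rw [← hrot _ hO']
        rw [lintegral_map hF (measurable_constMul _)]
    _ = _ := by simp

/-- first columns of the identity -/
def eMat (K : Type*) [RCLike K] {n r : ℕ} (c : Fin r → Fin n) : Matrix (Fin n) (Fin r) K :=
  (1 : Matrix (Fin n) (Fin n) K).submatrix id c

lemma eMat_orth {n r : ℕ} (c : Fin r → Fin n) (hc : Function.Injective c) :
    (eMat K c)ᴴ * eMat K c = 1 := by
  unfold eMat
  rw [conjTranspose_submatrix, conjTranspose_one, ← Matrix.submatrix_mul _ _ c id c
    Function.bijective_id, Matrix.one_mul]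
  exact Matrix.submatrix_one c hc

lemma qr_factor {n ℓ : ℕ} (h : ℓ ≤ n) (Z : Matrix (Fin n) (Fin ℓ) K) :
    ∃ V ∈ Matrix.unitaryGroup (Fin n) K, ∃ S : Matrix (Fin ℓ) (Fin ℓ) K,
      Z = V * eMat K (Fin.castLE h) * S := by
  obtain ⟨W, hW, hz⟩ := exists_qr h (fun k i => Z i k)
  refine ⟨Wᴴ, Unitary.star_mem hW, (W * Z).submatrix (Fin.castLE h) id, ?_⟩
  have h1 : eMat K (Fin.castLE h) * (W * Z).submatrix (Fin.castLE h) id = W * Z := by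
    ext i k
    by_cases hi : i.val < ℓ
    · rw [Matrix.mul_apply, Finset.sum_eq_single (⟨i, hi⟩ : Fin ℓ)]
      · have : i = Fin.castLE h ⟨i.val, hi⟩ := by ext; simp
        change (1 : Matrix (Fin n) (Fin n) K) i (Fin.castLE h ⟨i.val, hi⟩) *
          (W * Z) (Fin.castLE h ⟨i.val, hi⟩) k = (W * Z) i k
        rw [← this, Matrix.one_apply_eq, one_mul]
      · intro b _ hb
        have : i ≠ Fin.castLE h b := by
          intro h'; apply hb; ext; simp [h']
        simp [eMat, this]
      · simp
    · have h2 : (W * Z) i k = 0 := hz k i (by omega)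
      rw [h2, Matrix.mul_apply]
      refine Finset.sum_eq_zero fun b _ => ?_
      have : i ≠ Fin.castLE h b := by
        intro h'; apply hi; rw [h']; simp
      simp [eMat, this]
  rw [Matrix.mul_assoc, h1, ← Matrix.mul_assoc, unitary_mul' hW, Matrix.one_mul]

lemma continuous_conjMul {n ℓ r : ℕ} (Q : Matrix (Fin n) (Fin r) K) :
    Continuous fun Z : Matrix (Fin n) (Fin ℓ) K => Zᴴ * Q :=
  (continuous_id.matrix_conjTranspose).matrix_mul continuous_const

lemma continuous_frob {n ℓ : ℕ} : Continuous (frob : Matrix (Fin n) (Fin ℓ) K → ℝ) := by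
  unfold frob frobSq
  refine Real.continuous_sqrt.comp ?_
  refine continuous_finsetSum _ fun i _ => continuous_finsetSum _ fun j _ => ?_
  exact (continuous_norm.comp (continuous_id.matrix_elem i j)).pow 2

lemma measurable_ginvQ {n ℓ r : ℕ} (Q : Matrix (Fin n) (Fin r) K) :
    Measurable fun Z : Matrix (Fin n) (Fin ℓ) K => ginv (Zᴴ * Q) :=
  measurable_ginv.comp (continuous_conjMul Q).measurable

lemma measurable_wt {n ℓ r : ℕ} (Q : Matrix (Fin n) (Fin r) K) :
    Measurable fun Z : Matrix (Fin n) (Fin ℓ) K => ENNReal.ofReal (1 + frob Z) * ginv (Zᴴ * Q) :=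
  ((continuous_const.add continuous_frob).measurable.ennreal_ofReal).mul (measurable_ginvQ Q)

/-- the weighted integrability property -/
def Good {n ℓ r : ℕ} (lam : Measure (Matrix (Fin n) (Fin ℓ) K)) (Q : Matrix (Fin n) (Fin r) K) :
    Prop := ∫⁻ Z, ENNReal.ofReal (1 + frob Z) * ginv (Zᴴ * Q) ∂lam < ⊤

lemma gaussianMatrix_rot {n ℓ : ℕ} (U : Matrix (Fin n) (Fin n) K)
    (hU : U ∈ Matrix.unitaryGroup (Fin n) K) :
    Measure.map (fun Z => U * Z) (gaussianMatrix K n ℓ) = gaussianMatrix K n ℓ := by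
  rw [gaussianMatrix_eq]
  exact gamMat_rot U hU

instance gaussianMatrix_prob {n ℓ : ℕ} : IsProbabilityMeasure (gaussianMatrix K n ℓ) := by
  rw [gaussianMatrix_eq]
  exact gamMat_prob n ℓ

lemma good_gauss {n ℓ r : ℕ} (c : Fin r → Fin n) (hc : Function.Injective c)
    (hN : r + nfree K ≤ ℓ + 1) (V : Matrix (Fin n) (Fin n) K)
    (hV : V ∈ Matrix.unitaryGroup (Fin n) K) :
    Good (gaussianMatrix K n ℓ) (Vᴴ * eMat K c) := by
  unfold Good
  have hk := key_gauss (K := K) (n := n) (ℓ := ℓ) c hc hN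
  have h1 : ∫⁻ Z : Matrix (Fin n) (Fin ℓ) K, ENNReal.ofReal (1 + frob Z) * ginv (Zᴴ * eMat K c)
      ∂(gaussianMatrix K n ℓ) < ⊤ := by
    rw [gaussianMatrix_eq]
    refine lt_of_le_of_lt (le_of_eq ?_) hk
    refine lintegral_congr fun G => ?_
    congr 2
    ext i k
    simp [eMat, colM, Matrix.mul_apply, Matrix.one_apply]
  rw [← gaussianMatrix_rot V hV, lintegral_map (measurable_wt _)
    (measurable_constMul _)] at h1
  refine lt_of_le_of_lt (le_of_eq ?_) h1
  refine lintegral_congr fun Z => ?_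
  rw [frob_isometry V (unitary_mul' hV), conjTranspose_mul, Matrix.mul_assoc]

lemma good_orth {n ℓ r : ℕ} (hℓ : ℓ ≤ n) (Q : Matrix (Fin n) (Fin r) K)
    (hg : Good (gaussianMatrix K n ℓ) Q)
    (lam : Measure (Matrix (Fin n) (Fin ℓ) K)) [IsProbabilityMeasure lam]
    (hrot : ∀ U ∈ Matrix.unitaryGroup (Fin n) K, Measure.map (fun Z => U * Z) lam = lam)
    (horth : ∀ᵐ Z ∂lam, Zᴴ * Z = 1) : Good lam Q := by
  obtain ⟨η, hp, hη, hinv⟩ := exists_haar (K := K) n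
  set E := eMat K (Fin.castLE hℓ) with hE
  have hEE : Eᴴ * E = 1 := eMat_orth _ (Fin.castLE_injective hℓ)
  set J := ∫⁻ O, ginv ((Oᴴ * E)ᴴ * Q) ∂η with hJ
  have hJV : ∀ V ∈ Matrix.unitaryGroup (Fin n) K,
      ∫⁻ O, ginv ((Oᴴ * (V * E))ᴴ * Q) ∂η = J := by
    intro V hV
    have hV' : Vᴴ ∈ Matrix.unitaryGroup (Fin n) K := Unitary.star_mem hV
    rw [hJ]
    conv_rhs => rw [← hinv _ hV']
    rw [lintegral_map]
    · refine lintegral_congr fun O => ?_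
      rw [conjTranspose_mul Vᴴ O, conjTranspose_conjTranspose, Matrix.mul_assoc]
    · refine measurable_ginv.comp (Continuous.measurable ?_)
      exact ((continuous_id.matrix_conjTranspose).matrix_mul
        continuous_const).matrix_conjTranspose.matrix_mul continuous_const
    · exact (Continuous.matrix_mul continuous_const continuous_id).measurable
  -- decomposition
  have hdec : ∀ (V : Matrix (Fin n) (Fin n) K) (S : Matrix (Fin ℓ) (Fin ℓ) K)
      (O : Matrix (Fin n) (Fin n) K), (Oᴴ * (V * E * S))ᴴ * Q = Sᴴ * ((Oᴴ * (V * E))ᴴ * Q) := by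
    intro V S O
    rw [← Matrix.mul_assoc Oᴴ, conjTranspose_mul (Oᴴ * (V * E)), Matrix.mul_assoc]
  have hfr : ∀ V ∈ Matrix.unitaryGroup (Fin n) K, ∀ S : Matrix (Fin ℓ) (Fin ℓ) K,
      frob (V * E * S) = frob S := by
    intro V hV S
    rw [Matrix.mul_assoc, frob_isometry V (unitary_mul' hV), frob_isometry E hEE]
  have hJfin : J < ⊤ := by
    refine lt_of_le_of_lt ?_ hg
    rw [← avg_unitary (gaussianMatrix K n ℓ) gaussianMatrix_rot η hη _ (measurable_wt Q)]
    have hle : ∀ Z : Matrix (Fin n) (Fin ℓ) K, J ≤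
        ∫⁻ O, ENNReal.ofReal (1 + frob (Oᴴ * Z)) * ginv ((Oᴴ * Z)ᴴ * Q) ∂η := by
      intro Z
      obtain ⟨V, hV, S, rfl⟩ := qr_factor hℓ Z
      rw [← hJV V hV]
      refine lintegral_mono_ae ?_
      filter_upwards [hη] with O hO
      have hO' : Oᴴᴴ * Oᴴ = 1 := by rw [conjTranspose_conjTranspose]; exact unitary_mul hO
      rw [frob_isometry Oᴴ hO', ← hE, hfr V hV, hdec, ← frob_conjTranspose S]
      exact ginv_le_mul _ _
    calc J = ∫⁻ _Z, J ∂(gaussianMatrix K n ℓ) := by simp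
      _ ≤ _ := lintegral_mono hle
  have hfz : ∀ Z : Matrix (Fin n) (Fin ℓ) K, Zᴴ * Z = 1 → frob Z = Real.sqrt ℓ := by
    intro Z hZ
    rw [frob, frobSq_of_orthonormal Z hZ]
  have h1 : ∫⁻ Z, ginv (Zᴴ * Q) ∂lam ≤ ENNReal.ofReal (1 + Real.sqrt ℓ) * J := by
    rw [← avg_unitary lam hrot η hη _ (measurable_ginvQ Q)]
    calc _ ≤ ∫⁻ _Z, ENNReal.ofReal (1 + Real.sqrt ℓ) * J ∂lam := by
          refine lintegral_mono_ae ?_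
          filter_upwards [horth] with Z hZ
          obtain ⟨V, hV, S, hS⟩ := qr_factor hℓ Z
          have hSS : Sᴴ * S = 1 := by
            rw [← hZ, hS, ← hE]
            have : (V * E)ᴴ * (V * E) = 1 := by
              rw [conjTranspose_mul, Matrix.mul_assoc, ← Matrix.mul_assoc Vᴴ, unitary_mul' hV,
                Matrix.one_mul, hEE]
            rw [conjTranspose_mul (V * E), Matrix.mul_assoc, ← Matrix.mul_assoc (V * E)ᴴ, this,
              Matrix.one_mul]
          have hSS' : S * Sᴴ = 1 := mul_eq_one_comm.mp hSS
          rw [← hJV V hV, ← lintegral_const_mul']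
          · refine lintegral_mono fun O => ?_
            have h2 := ginv_le_mul S (Sᴴ * ((Oᴴ * (V * E))ᴴ * Q))
            rw [← Matrix.mul_assoc S, hSS', Matrix.one_mul] at h2
            rw [hS, ← hE, hdec, ← hfz Z hZ, hS, ← hE, hfr V hV]
            exact h2
          · simp
      _ = _ := by simp
  unfold Good
  calc ∫⁻ Z, ENNReal.ofReal (1 + frob Z) * ginv (Zᴴ * Q) ∂lam
      = ∫⁻ Z, ENNReal.ofReal (1 + Real.sqrt ℓ) * ginv (Zᴴ * Q) ∂lam := by
        refine lintegral_congr_ae ?_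
        filter_upwards [horth] with Z hZ
        rw [hfz Z hZ]
    _ = ENNReal.ofReal (1 + Real.sqrt ℓ) * ∫⁻ Z, ginv (Zᴴ * Q) ∂lam :=
        lintegral_const_mul _ (measurable_ginvQ Q)
    _ < ⊤ := ENNReal.mul_lt_top (by simp) (h1.trans_lt (ENNReal.mul_lt_top (by simp) hJfin))
end HaarPart

section FinalPart
variable {K : Type*} [RCLike K]

lemma moorePenrose_unique {m n : ℕ} {A : Matrix (Fin m) (Fin n) K} {X Y : Matrix (Fin n) (Fin m) K}
    (hX : IsMoorePenrose A X) (hY : IsMoorePenrose A Y) : X = Y := by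
  obtain ⟨x1, x2, x3, x4⟩ := hX
  obtain ⟨y1, y2, y3, y4⟩ := hY
  have h1 : A * X = A * Y := by
    calc A * X = (A * X)ᴴ := x3.symm
      _ = (A * Y * A * X)ᴴ := by rw [y1]
      _ = (A * X)ᴴ * (A * Y)ᴴ := by rw [Matrix.mul_assoc (A * Y), conjTranspose_mul (A * Y)]
      _ = A * X * A * Y := by rw [x3, y3, Matrix.mul_assoc, Matrix.mul_assoc, Matrix.mul_assoc]
      _ = A * Y := by rw [x1]
  have h2 : X * A = Y * A := by
    calc X * A = (X * A)ᴴ := x4.symm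
      _ = (X * (A * Y * A))ᴴ := by rw [y1]
      _ = (Y * A)ᴴ * (X * A)ᴴ := by
          rw [← conjTranspose_mul]; simp only [Matrix.mul_assoc]
      _ = Y * (A * X * A) := by rw [x4, y4]; simp only [Matrix.mul_assoc]
      _ = Y * A := by rw [x1]
  calc X = X * A * X := x2.symm
    _ = Y * A * X := by rw [h2]
    _ = Y * A * Y := by rw [Matrix.mul_assoc, h1, Matrix.mul_assoc]
    _ = Y := y2

/-- everything we need on the orthonormal basis of the range -/
lemma exists_Q [MeasurableSpace K] [BorelSpace K] {n d : ℕ} (A : Matrix (Fin n) (Fin d) K) :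
    ∃ c : Fin A.rank → Fin n, Function.Injective c ∧ ∃ V ∈ Matrix.unitaryGroup (Fin n) K,
      (Vᴴ * eMat K c) * (Vᴴ * eMat K c)ᴴ * A = A ∧
      ∃ Y : Matrix (Fin d) (Fin A.rank) K, A * Y = Vᴴ * eMat K c := by
  have hr : A.rank ≤ n := by simpa using A.rank_le_height
  let b : Module.Basis (Fin A.rank) K (LinearMap.range A.mulVecLin) :=
    Module.finBasisOfFinrankEq K _ rfl
  let Bm : Matrix (Fin n) (Fin A.rank) K := Matrix.of fun i k => (b k : Fin n → K) i
  let C : Matrix (Fin A.rank) (Fin d) K := Matrix.of fun k j =>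
    b.repr ⟨A *ᵥ Pi.single j 1, ⟨Pi.single j 1, rfl⟩⟩ k
  have hAC : A = Bm * C := by
    ext i j
    have h := b.sum_repr ⟨A *ᵥ Pi.single j 1, ⟨Pi.single j 1, rfl⟩⟩
    have h2 := congrFun (congrArg (fun z : LinearMap.range A.mulVecLin => (z : Fin n → K)) h) i
    simp only [Submodule.coe_sum, Submodule.coe_smul, Finset.sum_apply, Pi.smul_apply,
      smul_eq_mul] at h2
    rw [Matrix.mul_apply]
    have h3 : (A *ᵥ Pi.single j 1) i = A i j := by simp
    rw [← h3, ← h2]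
    refine Finset.sum_congr rfl fun k _ => ?_
    simp only [Bm, C, Matrix.of_apply]
    exact mul_comm _ _
  obtain ⟨V, hV, S, hS⟩ := qr_factor hr Bm
  refine ⟨Fin.castLE hr, Fin.castLE_injective hr, Vᴴ, Unitary.star_mem hV, ?_⟩
  rw [conjTranspose_conjTranspose]
  set E := eMat K (Fin.castLE hr)
  have hEE : Eᴴ * E = 1 := eMat_orth _ (Fin.castLE_injective hr)
  have hQ : (V * E)ᴴ * (V * E) = 1 := by
    rw [conjTranspose_mul, Matrix.mul_assoc, ← Matrix.mul_assoc Vᴴ, unitary_mul' hV,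
      Matrix.one_mul, hEE]
  have h1 : (V * E) * (V * E)ᴴ * A = A := by
    have h0 : A = V * E * (S * C) := by rw [← Matrix.mul_assoc, ← hS]; exact hAC
    calc (V * E) * (V * E)ᴴ * A = (V * E) * (V * E)ᴴ * (V * E * (S * C)) :=
          congrArg (fun z => (V * E) * (V * E)ᴴ * z) h0
      _ = V * E * (((V * E)ᴴ * (V * E)) * (S * C)) := by simp only [Matrix.mul_assoc]
      _ = V * E * (S * C) := by rw [hQ, Matrix.one_mul]
      _ = A := h0.symm
  refine ⟨h1, ?_⟩
  set R := (V * E)ᴴ * A with hR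
  have hAR : A = V * E * R := by rw [hR, ← Matrix.mul_assoc, h1]
  have hrk : A.rank ≤ R.rank := by
    have h2 := Matrix.rank_mul_le_right (V * E) R
    rwa [← hAR] at h2
  have hsurj : Function.Surjective R.mulVec := by
    have h3 : LinearMap.range R.mulVecLin = ⊤ := by
      apply Submodule.eq_top_of_finrank_eq
      refine le_antisymm (Submodule.finrank_le _) ?_
      rw [Module.finrank_fin_fun]
      exact hrk
    exact LinearMap.range_eq_top.mp h3
  obtain ⟨Y, hY⟩ := Matrix.mulVec_surjective_iff_exists_right_inverse.mp hsurj
  refine ⟨Y, ?_⟩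
  calc A * Y = V * E * R * Y := congrArg (fun z => z * Y) hAR
    _ = V * E := by rw [Matrix.mul_assoc, hY, Matrix.mul_one]

/-- the noise term -/
def noise {n ℓ r p : ℕ} (Q : Matrix (Fin n) (Fin r) K) (Bp : Matrix (Fin n) (Fin p) K)
    (Z : Matrix (Fin n) (Fin ℓ) K) : Matrix (Fin r) (Fin p) K :=
  ((Zᴴ * Q)ᴴ * (Zᴴ * Q))⁻¹ * (Zᴴ * Q)ᴴ * (Zᴴ * Bp)

lemma pinv_sketch {n ℓ d r p : ℕ} {A : Matrix (Fin n) (Fin d) K} {B : Matrix (Fin n) (Fin p) K}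
    {X : Matrix (Fin d) (Fin n) K} (hX : IsMoorePenrose A X) {Q : Matrix (Fin n) (Fin r) K}
    (hQ : Qᴴ * Q = 1) (hQA : Q * Qᴴ * A = A) {Y : Matrix (Fin d) (Fin r) K} (hY : A * Y = Q)
    {Z : Matrix (Fin n) (Fin ℓ) K} (hdet : IsUnit ((Zᴴ * Q)ᴴ * (Zᴴ * Q)).det)
    {W : Matrix (Fin d) (Fin ℓ) K} (hW : IsMoorePenrose (Zᴴ * A) W) :
    W * (Zᴴ * B) = X * B + X * Q * noise Q (B - Q * Qᴴ * B) Z := by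
  obtain ⟨x1, x2, x3, x4⟩ := hX
  set T := Zᴴ * Q with hT
  set N := (Tᴴ * T)⁻¹ * Tᴴ with hN
  have hNT : N * T = 1 := by
    rw [hN, Matrix.mul_assoc, Matrix.nonsing_inv_mul _ hdet]
  have hTN : (T * N)ᴴ = T * N := by
    have h1 : ((Tᴴ * T)⁻¹)ᴴ = (Tᴴ * T)⁻¹ := by
      rw [conjTranspose_nonsing_inv, conjTranspose_mul, conjTranspose_conjTranspose]
    rw [hN, conjTranspose_mul, conjTranspose_mul, conjTranspose_conjTranspose, h1,
      Matrix.mul_assoc]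
  have hAXQ : A * X * Q = Q := by rw [← hY, ← Matrix.mul_assoc, x1]
  have hXQQ : X * Q * Qᴴ = X := by
    have h1 : Aᴴ * Q * Qᴴ = Aᴴ := by
      have := congrArg conjTranspose hQA
      rwa [conjTranspose_mul, conjTranspose_mul, conjTranspose_conjTranspose,
        ← Matrix.mul_assoc] at this
    have h2 : X = X * Xᴴ * Aᴴ := by
      conv_lhs => rw [← x2, Matrix.mul_assoc, ← x3, conjTranspose_mul]
      rw [Matrix.mul_assoc]
    calc X * Q * Qᴴ = X * Xᴴ * (Aᴴ * Q * Qᴴ) := by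
          conv_lhs => rw [h2]
          simp only [Matrix.mul_assoc]
      _ = X := by rw [h1, ← h2]
  have hZA : Zᴴ * A = T * (Qᴴ * A) := by
    conv_lhs => rw [← hQA]
    rw [hT]; simp only [Matrix.mul_assoc]
  have hRX : (Qᴴ * A) * (X * Q) = 1 := by
    calc (Qᴴ * A) * (X * Q) = Qᴴ * (A * X * Q) := by simp only [Matrix.mul_assoc]
      _ = 1 := by rw [hAXQ, hQ]
  have e1 : Zᴴ * A * (X * Q * N) = T * N := by
    rw [hZA]
    calc T * (Qᴴ * A) * (X * Q * N) = T * ((Qᴴ * A) * (X * Q)) * N := by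
          simp only [Matrix.mul_assoc]
      _ = T * N := by rw [hRX, Matrix.mul_one]
  have e2 : X * Q * N * (Zᴴ * A) = X * A := by
    rw [hZA]
    calc X * Q * N * (T * (Qᴴ * A)) = X * Q * (N * T) * Qᴴ * A := by simp only [Matrix.mul_assoc]
      _ = X * A := by rw [hNT, Matrix.mul_one, hXQQ]
  have hMP : IsMoorePenrose (Zᴴ * A) (X * Q * N) := by
    refine ⟨?_, ?_, ?_, ?_⟩
    · rw [e1, hZA]
      calc T * N * (T * (Qᴴ * A)) = T * (N * T) * (Qᴴ * A) := by simp only [Matrix.mul_assoc]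
        _ = _ := by rw [hNT, Matrix.mul_one]
    · rw [e2]
      calc X * A * (X * Q * N) = (X * A * X) * Q * N := by simp only [Matrix.mul_assoc]
        _ = _ := by rw [x2]
    · rw [e1, hTN]
    · rw [e2, x4]
  rw [moorePenrose_unique hW hMP]
  have hnoise : noise Q (B - Q * Qᴴ * B) Z = N * (Zᴴ * B) - Qᴴ * B := by
    unfold noise
    rw [← hT, ← hN, Matrix.mul_sub Zᴴ, Matrix.mul_sub N]
    congr 1
    calc N * (Zᴴ * (Q * Qᴴ * B)) = N * T * (Qᴴ * B) := by rw [hT]; simp only [Matrix.mul_assoc]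
      _ = _ := by rw [hNT, Matrix.one_mul]
  rw [hnoise, Matrix.mul_sub, ← Matrix.mul_assoc (X * Q) Qᴴ, hXQQ, ← Matrix.mul_assoc (X * Q) N]
  abel

lemma noise_reflect {n ℓ r p : ℕ} (Q : Matrix (Fin n) (Fin r) K) (hQ : Qᴴ * Q = 1)
    (Bp : Matrix (Fin n) (Fin p) K) (hB : Qᴴ * Bp = 0) :
    ∃ U ∈ Matrix.unitaryGroup (Fin n) K, ∀ Z : Matrix (Fin n) (Fin ℓ) K,
      noise Q Bp (U * Z) = - noise Q Bp Z := by
  set U : Matrix (Fin n) (Fin n) K := Q * Qᴴ + Q * Qᴴ - 1 with hU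
  have hUH : Uᴴ = U := by simp [hU]
  have hPP : Q * Qᴴ * (Q * Qᴴ) = Q * Qᴴ := by
    rw [Matrix.mul_assoc, ← Matrix.mul_assoc Qᴴ, hQ, Matrix.one_mul]
  have hUU : U * U = 1 := by
    rw [hU]
    simp only [Matrix.mul_sub, Matrix.sub_mul, Matrix.mul_add, Matrix.add_mul, hPP, Matrix.mul_one,
      Matrix.one_mul]
    abel
  have hUQ : U * Q = Q := by
    rw [hU, Matrix.sub_mul, Matrix.add_mul, Matrix.mul_assoc, hQ, Matrix.mul_one, Matrix.one_mul]
    abel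
  have hUB : U * Bp = - Bp := by
    rw [hU, Matrix.sub_mul, Matrix.add_mul, Matrix.mul_assoc, hB, Matrix.mul_zero, Matrix.one_mul]
    abel
  refine ⟨U, ?_, fun Z => ?_⟩
  · rw [Matrix.mem_unitaryGroup_iff, Matrix.star_eq_conjTranspose, hUH, hUU]
  · unfold noise
    rw [conjTranspose_mul U Z, hUH, Matrix.mul_assoc Zᴴ U Q, hUQ, Matrix.mul_assoc Zᴴ U Bp, hUB]
    simp only [Matrix.mul_neg]

variable [MeasurableSpace K] [BorelSpace K]

lemma measurable_matInv {r : ℕ} (a b : Fin r) :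
    Measurable fun M : Matrix (Fin r) (Fin r) K => M⁻¹ a b := by
  have h : (fun M : Matrix (Fin r) (Fin r) K => M⁻¹ a b) =
      fun M => (M.det)⁻¹ * M.adjugate a b := by
    ext M
    rw [Matrix.inv_def, Matrix.smul_apply, smul_eq_mul, Ring.inverse_eq_inv']
  rw [h]
  have h1 : Continuous fun M : Matrix (Fin r) (Fin r) K => M.det := continuous_id.matrix_det
  have h2 : Continuous fun M : Matrix (Fin r) (Fin r) K => M.adjugate a b :=
    continuous_id.matrix_adjugate.matrix_elem a b
  exact h1.measurable.inv.mul h2.measurable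

lemma measurable_noise {n ℓ r p : ℕ} (Q : Matrix (Fin n) (Fin r) K)
    (Bp : Matrix (Fin n) (Fin p) K) (k : Fin r) (j : Fin p) :
    Measurable fun Z : Matrix (Fin n) (Fin ℓ) K => noise Q Bp Z k j := by
  unfold noise
  simp_rw [Matrix.mul_assoc (_)⁻¹ _ _]
  simp_rw [Matrix.mul_apply (M := (_)⁻¹)]
  refine Finset.measurable_sum _ fun a _ => Measurable.mul ?_ ?_
  · have hc : Continuous fun Z : Matrix (Fin n) (Fin ℓ) K => (Zᴴ * Q)ᴴ * (Zᴴ * Q) :=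
      (continuous_conjMul Q).matrix_conjTranspose.matrix_mul (continuous_conjMul Q)
    exact (measurable_matInv k a).comp hc.measurable
  · have hc : Continuous fun Z : Matrix (Fin n) (Fin ℓ) K => (Zᴴ * Q)ᴴ * (Zᴴ * Bp) :=
      (continuous_conjMul Q).matrix_conjTranspose.matrix_mul (continuous_conjMul Bp)
    exact (hc.matrix_elem a j).measurable

lemma good_ae {n ℓ r : ℕ} {lam : Measure (Matrix (Fin n) (Fin ℓ) K)} {Q : Matrix (Fin n) (Fin r) K}
    (h : Good lam Q) : ∀ᵐ Z ∂lam, ginv (Zᴴ * Q) ≠ ⊤ := by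
  filter_upwards [ae_lt_top (measurable_wt Q) h.ne] with Z hZ htop
  rw [htop, ENNReal.mul_top] at hZ
  · exact lt_irrefl _ hZ
  · have := frob_nonneg Z
    rw [Ne, ENNReal.ofReal_eq_zero, not_le]; linarith

lemma integrable_noise {n ℓ r p : ℕ} {lam : Measure (Matrix (Fin n) (Fin ℓ) K)}
    {Q : Matrix (Fin n) (Fin r) K} (h : Good lam Q) (Bp : Matrix (Fin n) (Fin p) K)
    (k : Fin r) (j : Fin p) : Integrable (fun Z => noise Q Bp Z k j) lam := by
  refine ⟨(measurable_noise Q Bp k j).aestronglyMeasurable, ?_⟩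
  set b : Fin n → K := fun i => Bp i j with hb
  have hle : ∫⁻ Z, ‖noise Q Bp Z k j‖ₑ ∂lam ≤
      ∫⁻ Z, (ENNReal.ofReal (1 + frob Z) * ginv (Zᴴ * Q)) * ENNReal.ofReal (l2 b) ∂lam := by
    refine lintegral_mono_ae ?_
    filter_upwards [good_ae h] with Z hZ
    have h1 := norm_pinv_le hZ (Zᴴ *ᵥ b) k
    have h2 : noise Q Bp Z k j = ((((Zᴴ * Q)ᴴ * (Zᴴ * Q))⁻¹ * (Zᴴ * Q)ᴴ) *ᵥ (Zᴴ *ᵥ b)) k := rfl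
    rw [h2]
    refine h1.trans ?_
    rw [mul_comm (ENNReal.ofReal (1 + frob Z)), mul_assoc]
    gcongr
    have h3 := frob_nonneg Z
    rw [← ENNReal.ofReal_mul (by linarith)]
    apply ENNReal.ofReal_le_ofReal
    have h4 := l2_mulVec_le Zᴴ b
    rw [frob_conjTranspose] at h4
    have := l2_nonneg b
    nlinarith
  refine lt_of_le_of_lt hle ?_
  rw [lintegral_mul_const _ (measurable_wt Q)]
  exact ENNReal.mul_lt_top h (by simp)

lemma unbiased_of_good {n ℓ d p r : ℕ} {Y : Type*} [MeasurableSpace Y] (μ : Measure Y)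
    [IsProbabilityMeasure μ] (M : Y → Matrix (Fin n) (Fin ℓ) K) (hM : Measurable M)
    (hrot : RotationInvariant μ M)
    (pv : Matrix (Fin ℓ) (Fin d) K → Matrix (Fin d) (Fin ℓ) K)
    (hpv : ∀ A, IsMoorePenrose A (pv A))
    {A : Matrix (Fin n) (Fin d) K} {B : Matrix (Fin n) (Fin p) K}
    {X : Matrix (Fin d) (Fin n) K} (hX : IsMoorePenrose A X) {Q : Matrix (Fin n) (Fin r) K}
    (hQ : Qᴴ * Q = 1) (hQA : Q * Qᴴ * A = A) {W : Matrix (Fin d) (Fin r) K} (hW : A * W = Q)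
    (hg : Good (Measure.map M μ) Q) (i : Fin d) (j : Fin p) :
    ∫ ω, (pv ((M ω)ᴴ * A) * ((M ω)ᴴ * B)) i j ∂μ = (X * B) i j := by
  set Bp := B - Q * Qᴴ * B with hBp
  have hQB : Qᴴ * Bp = 0 := by
    rw [hBp, Matrix.mul_sub, Matrix.mul_assoc Q, ← Matrix.mul_assoc Qᴴ Q, hQ, Matrix.one_mul,
      sub_self]
  have hae := ae_of_ae_map hM.aemeasurable (good_ae hg)
  have hint : ∀ k, Integrable (fun ω => noise Q Bp (M ω) k j) μ := fun k =>
    (integrable_noise hg Bp k j).comp_measurable hM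
  have hzero : ∀ k, ∫ ω, noise Q Bp (M ω) k j ∂μ = 0 := by
    intro k
    obtain ⟨U, hU, hneg⟩ := noise_reflect (ℓ := ℓ) Q hQ Bp hQB
    have hm := measurable_noise (ℓ := ℓ) Q Bp k j
    have e1 : ∫ ω, noise Q Bp (M ω) k j ∂μ = ∫ Z, noise Q Bp Z k j ∂(Measure.map M μ) :=
      (integral_map hM.aemeasurable hm.aestronglyMeasurable).symm
    have hUM : Measurable fun ω => U * M ω := (measurable_constMul U).comp hM
    have e2 : ∫ Z, noise Q Bp Z k j ∂(Measure.map M μ) = ∫ ω, noise Q Bp (U * M ω) k j ∂μ := by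
      rw [← hrot U hU, integral_map hUM.aemeasurable hm.aestronglyMeasurable]
    have e3 : ∫ ω, noise Q Bp (U * M ω) k j ∂μ = - ∫ ω, noise Q Bp (M ω) k j ∂μ := by
      rw [← integral_neg]
      simp_rw [hneg, Matrix.neg_apply]
    have e4 : ∫ ω, noise Q Bp (M ω) k j ∂μ = - ∫ ω, noise Q Bp (M ω) k j ∂μ := by
      rw [← e3, ← e2, ← e1]
    exact self_eq_neg.mp e4
  calc ∫ ω, (pv ((M ω)ᴴ * A) * ((M ω)ᴴ * B)) i j ∂μ
      = ∫ ω, ((X * B) i j + ∑ k, (X * Q) i k * noise Q Bp (M ω) k j) ∂μ := by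
        refine integral_congr_ae ?_
        filter_upwards [hae] with ω hω
        rw [pinv_sketch (B := B) hX hQ hQA hW (ginv_isUnit_det hω) (hpv _), Matrix.add_apply,
          Matrix.mul_apply (M := X * Q)]
    _ = (X * B) i j := by
        rw [integral_add (integrable_const _)
          (integrable_finsetSum _ fun k _ => (hint k).const_mul _),
          integral_finsetSum _ fun k _ => (hint k).const_mul _]
        simp [integral_const_mul, hzero]
end FinalPart

/-- **Sketch-and-solve is unbiased** (Theorem 2.1, expectation part):
for a Gaussian or random orthonormal embedding `Ω` and matrices `A, B` with
`rank A < ℓ − α_K`, the sketch-and-solve solution `X̂ = (Ω*A)⁺(Ω*B)` satisfies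
`E[X̂] = A⁺B` (entrywise). -/
theorem sketch_and_solve_unbiased
    {K : Type*} [RCLike K] [MeasurableSpace K] [BorelSpace K]
    {Y : Type*} [MeasurableSpace Y] (μ : Measure Y) [IsProbabilityMeasure μ]
    (pinv : (m n : ℕ) → Matrix (Fin m) (Fin n) K → Matrix (Fin n) (Fin m) K)
    (hpinv : ∀ (m n : ℕ) (A : Matrix (Fin m) (Fin n) K), IsMoorePenrose A (pinv m n A))
    (n ℓ d p : ℕ) (hℓn : ℓ ≤ n)
    (M : Y → Matrix (Fin n) (Fin ℓ) K)
    (hM : IsGaussianEmbedding μ M ∨ IsRandomOrthonormal μ M)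
    (A : Matrix (Fin n) (Fin d) K) (B : Matrix (Fin n) (Fin p) K)
    (hrank : (A.rank : ℝ) < (ℓ : ℝ) - alphaK K) :
    ∀ i j, (∫ ω, (pinv ℓ d ((M ω)ᴴ * A) * ((M ω)ᴴ * B)) i j ∂μ)
      = (pinv n d A * B) i j := by
  classical
  intro i j
  obtain ⟨c, hc, V, hV, hQA, W, hW⟩ := exists_Q A
  have hN : A.rank + nfree K ≤ ℓ + 1 := by
    unfold alphaK at hrank
    unfold nfree
    by_cases hI : (RCLike.I : K) = 0
    · simp only [hI, if_true] at hrank ⊢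
      have : A.rank + 1 < ℓ := by
        have h : (A.rank : ℝ) + 1 < ℓ := by linarith
        exact_mod_cast h
      omega
    · simp only [hI, if_false, sub_zero] at hrank ⊢
      have : A.rank < ℓ := by exact_mod_cast hrank
      omega
  have hgauss := good_gauss (K := K) (ℓ := ℓ) c hc hN V hV
  have hQ : (Vᴴ * eMat K c)ᴴ * (Vᴴ * eMat K c) = 1 := by
    rw [conjTranspose_mul, conjTranspose_conjTranspose, Matrix.mul_assoc, ← Matrix.mul_assoc V,
      unitary_mul hV, Matrix.one_mul, eMat_orth c hc]
  rcases hM with ⟨hMm, hlaw⟩ | ⟨hMm, hrot, horth⟩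
  · have hrot : RotationInvariant μ M := by
      intro U hU
      have h := gaussianMatrix_rot (K := K) (ℓ := ℓ) U hU
      rw [← hlaw, Measure.map_map (measurable_constMul U) hMm] at h
      exact h
    exact unbiased_of_good μ M hMm hrot (pinv ℓ d) (hpinv ℓ d) (hpinv n d A) hQ hQA hW
      (by rw [hlaw]; exact hgauss) i j
  · have hp : IsProbabilityMeasure (Measure.map M μ) :=
      Measure.isProbabilityMeasure_map hMm.aemeasurable
    have hg : Good (Measure.map M μ) (Vᴴ * eMat K c) := by
      refine good_orth hℓn _ hgauss (Measure.map M μ) ?_ ?_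
      · intro U hU
        have h := hrot U hU
        rw [Measure.map_map (measurable_constMul U) hMm]
        exact h
      · have hcont : Continuous fun Z : Matrix (Fin n) (Fin ℓ) K => Zᴴ * Z :=
          (continuous_id.matrix_conjTranspose).matrix_mul continuous_id
        rw [ae_map_iff hMm.aemeasurable]
        · exact horth
        · exact (isClosed_eq hcont continuous_const).measurableSet
    exact unbiased_of_good μ M hMm hrot (pinv ℓ d) (hpinv ℓ d) (hpinv n d A) hQ hQA hW hg i j
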